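/- Let u_ε be a sequence of solutions of (E_ε), fix p = p_{j,2} ∈ Z₂ and small r > 0, and let û_ε(x) := u_ε(εx) in local coordinates centered so that û_ε solves Δû_ε + f_τ(û_ε) = −4π m_{j,2} δ_p on B_{r/ε}(p). Then there exists a constant c > 0, independent of r and ε, such that |∇û_ε(x) + 2 m_{j,2} (x − p)/|x − p|²| ≤ c for all x ∈ B_{r/ε}(p). -/

import Mathlib

open MeasureTheory Real Filter Set Metric Topology

noncomputable section

/-- The Euclidean plane `ℝ²`. -/
abbrev Pl := EuclideanSpace ℝ (Fin 2)

/-- The unit lattice `ℤ² ⊆ ℝ²`; the flat 2-torus `Ω` is its quotient, which we model by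
working with doubly periodic functions on the plane. -/
def unitLattice : Set Pl :=
  {v | ∃ a b : ℤ, v = (a : ℝ) • EuclideanSpace.single 0 (1:ℝ) +
      (b : ℝ) • EuclideanSpace.single 1 (1:ℝ)}

/-- A fundamental domain for the torus `Ω` (of total area `|Ω| = 1`). -/
def fund : Set Pl := {x | x 0 ∈ Ico (0:ℝ) 1 ∧ x 1 ∈ Ico (0:ℝ) 1}

/-- A doubly periodic function on the plane, i.e. a function on the torus `Ω`. -/
def Periodic2 (u : Pl → ℝ) : Prop := ∀ x : Pl, ∀ v ∈ unitLattice, u (x + v) = u x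

/-- Partial derivative in the `i`-th coordinate direction. -/
def pd (u : Pl → ℝ) (i : Fin 2) : Pl → ℝ :=
  fun x => lineDeriv ℝ u x (EuclideanSpace.single i (1:ℝ))

/-- The Laplacian `Δu`. -/
def lap (u : Pl → ℝ) (x : Pl) : ℝ := pd (pd u 0) 0 x + pd (pd u 1) 1 x

/-- `|∇u|²`. -/
def gradSq (u : Pl → ℝ) (x : Pl) : ℝ := (pd u 0 x) ^ 2 + (pd u 1 x) ^ 2

/-- The nonlinearity `f_τ(t) = e^t (1 − e^t) / (τ + e^t)³`. -/
def fτ (τ t : ℝ) : ℝ := exp t * (1 - exp t) / (τ + exp t) ^ 3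

/-- `f_τ'(t) = e^t (τ − 2(τ+1) e^t + e^{2t}) / (τ + e^t)⁴`. -/
def fτ' (τ t : ℝ) : ℝ := exp t * (τ - 2 * (τ + 1) * exp t + exp (2 * t)) / (τ + exp t) ^ 4

/-- The antiderivative `F_{2,τ}(t) = e^t ((1−τ) e^t + 2τ) / (2τ² (τ+e^t)²)` of `f_τ`. -/
def F2τ (τ t : ℝ) : ℝ := exp t * ((1 - τ) * exp t + 2 * τ) / (2 * τ ^ 2 * (τ + exp t) ^ 2)

/-- `u − 2a ln‖· − p‖` extends smoothly across `p`: this encodes the distributional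
equation `Δu = 4πa δ_p + (smooth)` near `p`. -/
def LogSing (u : Pl → ℝ) (p : Pl) (a : ℝ) : Prop :=
  ∃ r > 0, ∃ v : Pl → ℝ, ContDiffOn ℝ (⊤ : ℕ∞) v (ball p r) ∧
    ∀ x ∈ ball p r, x ≠ p → u x = 2 * a * Real.log ‖x - p‖ + v x

/-- The vortex data: distinct points `p_{j,1}` (`1 ≤ j ≤ d₁`), `p_{j,2}` (`1 ≤ j ≤ d₂`)
of the torus with multiplicities `m_{j,1} ≥ 0`, `m_{j,2} ≥ 0`. -/
structure VortexData where
  d₁ : ℕ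
  d₂ : ℕ
  p₁ : Fin d₁ → Pl
  p₂ : Fin d₂ → Pl
  m₁ : Fin d₁ → ℝ
  m₂ : Fin d₂ → ℝ
  m₁_nonneg : ∀ j, 0 ≤ m₁ j
  m₂_nonneg : ∀ j, 0 ≤ m₂ j
  distinct : ∀ i j : Fin d₁ ⊕ Fin d₂, i ≠ j → ∀ v ∈ unitLattice,
      Sum.elim p₁ p₂ i ≠ Sum.elim p₁ p₂ j + v

namespace VortexData
variable (V : VortexData)

/-- The set `Z₁` of vortex points `p_{j,1}` (viewed in the plane: all lattice translates). -/
def Z1 : Set Pl := {x | ∃ j v, v ∈ unitLattice ∧ x = V.p₁ j + v}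

/-- The set `Z₂` of vortex points `p_{j,2}` (viewed in the plane: all lattice translates). -/
def Z2 : Set Pl := {x | ∃ j v, v ∈ unitLattice ∧ x = V.p₂ j + v}

/-- The full vortex set `Z = Z₁ ∪ Z₂`. -/
def Z : Set Pl := V.Z1 ∪ V.Z2

/-- `N₁ = Σ_j m_{j,1}`. -/
def N1 : ℝ := ∑ j, V.m₁ j

/-- `N₂ = Σ_j m_{j,2}`. -/
def N2 : ℝ := ∑ j, V.m₂ j

end VortexData

/-- `u` is a solution of `(E_ε)`:
`Δu + ε⁻² f_τ(u) = 4π Σ_j m_{j,1} δ_{p_{j,1}} − 4π Σ_j m_{j,2} δ_{p_{j,2}}` on `Ω`,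
formulated classically: `u` is doubly periodic, smooth away from `Z`, solves the PDE
classically off `Z`, and has the prescribed logarithmic singularities at the vortices. -/
structure IsSolution (V : VortexData) (τ ε : ℝ) (u : Pl → ℝ) : Prop where
  periodic : Periodic2 u
  smooth : ContDiffOn ℝ (⊤ : ℕ∞) u (V.Z)ᶜ
  pde : ∀ x ∉ V.Z, lap u x + (ε ^ 2)⁻¹ * fτ τ (u x) = 0
  sing₁ : ∀ j, LogSing u (V.p₁ j) (V.m₁ j)
  sing₂ : ∀ j, LogSing u (V.p₂ j) (-(V.m₂ j))

/-- The quadratic form `∫_Ω |∇φ|² − ε⁻² f_τ'(u) φ²` of the linearized operator at `u`. -/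
def QuadForm (τ ε : ℝ) (u φ : Pl → ℝ) : ℝ :=
  ∫ x in fund, (gradSq φ x - (ε ^ 2)⁻¹ * fτ' τ (u x) * (φ x) ^ 2)

/-- `u` is a stable solution: the first eigenvalue `μ_ε` of the linearized operator is
nonnegative, i.e. the quadratic form is nonnegative on all (smooth, doubly periodic)
test functions. -/
def Stable (τ ε : ℝ) (u : Pl → ℝ) : Prop :=
  ∀ φ : Pl → ℝ, ContDiff ℝ (⊤ : ℕ∞) φ → Periodic2 φ → 0 ≤ QuadForm τ ε u φ

/-- `u` is strictly stable: the first eigenvalue `μ_ε` of the linearized operator is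
strictly positive. -/
def StrictlyStable (τ ε : ℝ) (u : Pl → ℝ) : Prop :=
  ∃ μ > 0, ∀ φ : Pl → ℝ, ContDiff ℝ (⊤ : ℕ∞) φ → Periodic2 φ →
    μ * (∫ x in fund, (φ x) ^ 2) ≤ QuadForm τ ε u φ

section
open scoped ComplexConjugate ContDiff

/-- `∂_v g` in the plane `ℂ`. -/
def dv {F : Type*} [NormedAddCommGroup F] [NormedSpace ℝ F] (v : ℂ) (g : ℂ → F) (z : ℂ) : F :=
  fderiv ℝ g z v

def kN (s : ℝ) (z : ℂ) : ℝ := z.re ^ 2 + z.im ^ 2 + s ^ 2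

def kS (s : ℝ) (z : ℂ) : ℂ := (kN s z)⁻¹ • conj z

lemma kN_eq (s : ℝ) (z : ℂ) : kN s z = ‖z‖ ^ 2 + s ^ 2 := by
  rw [kN, ← Complex.normSq_eq_norm_sq, Complex.normSq_apply]; ring

lemma kN_pos {s : ℝ} (hs : 0 < s) (z : ℂ) : 0 < kN s z := by
  unfold kN; positivity

lemma kN_smooth (s : ℝ) : ContDiff ℝ ∞ (kN s) := by
  unfold kN
  have h1 : ContDiff ℝ ∞ (fun z : ℂ => z.re) := Complex.reCLM.contDiff
  have h2 : ContDiff ℝ ∞ (fun z : ℂ => z.im) := Complex.imCLM.contDiff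
  fun_prop

lemma kS_smooth {s : ℝ} (hs : 0 < s) : ContDiff ℝ ∞ (kS s) := by
  unfold kS
  have h1 : ContDiff ℝ ∞ (fun z : ℂ => conj z) := Complex.conjCLE.contDiff
  exact ((kN_smooth s).inv (fun z => (kN_pos hs z).ne')).smul h1

lemma kN_hasFDerivAt (s : ℝ) (z : ℂ) :
    HasFDerivAt (kN s) ((2 * z.re) • Complex.reCLM + (2 * z.im) • Complex.imCLM) z := by
  have h1 : HasFDerivAt (fun z : ℂ => z.re) Complex.reCLM z := Complex.reCLM.hasFDerivAt
  have h2 : HasFDerivAt (fun z : ℂ => z.im) Complex.imCLM z := Complex.imCLM.hasFDerivAt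
  have := ((h1.pow 2).add (h2.pow 2)).add_const (s ^ 2)
  have e : (2 * z.re) • Complex.reCLM + (2 * z.im) • Complex.imCLM =
    (2 • z.re ^ (2 - 1)) • Complex.reCLM + (2 • z.im ^ (2 - 1)) • Complex.imCLM := by
    simp
  rw [e]
  exact this

lemma dv_kS {s : ℝ} (hs : 0 < s) (z v : ℂ) :
    dv v (kS s) z = (kN s z)⁻¹ • conj v
      + (-(kN s z ^ 2)⁻¹ * (2 * z.re * v.re + 2 * z.im * v.im)) • conj z := by
  have h1 : HasFDerivAt (fun z : ℂ => conj z) (Complex.conjCLE : ℂ →L[ℝ] ℂ) z :=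
    Complex.conjCLE.hasFDerivAt
  have h2 := (hasDerivAt_inv (kN_pos hs z).ne').comp_hasFDerivAt z (kN_hasFDerivAt s z)
  have h3 : HasFDerivAt (kS s) _ z := h2.smul h1
  rw [dv, h3.fderiv]
  simp only [Function.comp]
  generalize (kN s z ^ 2)⁻¹ = a
  generalize (kN s z)⁻¹ = b
  simp
  ring

lemma D_kS {s : ℝ} (hs : 0 < s) (z : ℂ) :
    dv 1 (kS s) z + Complex.I * dv Complex.I (kS s) z = ((2 * s ^ 2 / kN s z ^ 2 : ℝ) : ℂ) := by
  rw [dv_kS hs, dv_kS hs]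
  have h := (kN_pos hs z).ne'
  have e : 2 * s ^ 2 / kN s z ^ 2 = 2 * (kN s z)⁻¹ - 2 * (kN s z ^ 2)⁻¹ * (z.re ^ 2 + z.im ^ 2) := by
    field_simp
    unfold kN; ring
  rw [e]
  generalize (kN s z ^ 2)⁻¹ = a
  generalize (kN s z)⁻¹ = b
  apply Complex.ext
  · simp [pow_two]
    ring
  · simp [pow_two]; ring

lemma Dbar_kS {s : ℝ} (hs : 0 < s) (z : ℂ) :
    ‖dv 1 (kS s) z - Complex.I * dv Complex.I (kS s) z‖ ≤ 2 * (‖z‖ ^ 2)⁻¹ := by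
  have : dv 1 (kS s) z - Complex.I * dv Complex.I (kS s) z
      = ((-2 * (kN s z ^ 2)⁻¹ : ℝ) : ℂ) * (conj z) ^ 2 := by
    rw [dv_kS hs, dv_kS hs]
    generalize (kN s z ^ 2)⁻¹ = a
    generalize (kN s z)⁻¹ = b
    apply Complex.ext
    · simp [pow_two]
      ring
    · simp [pow_two]; ring
  rw [this, norm_mul, norm_pow, RCLike.norm_conj, Complex.norm_real]
  have h := kN_pos hs z
  have h2 : ‖z‖ ^ 2 ≤ kN s z := by rw [kN_eq]; nlinarith
  rw [Real.norm_eq_abs, abs_mul, abs_inv, abs_of_pos (pow_pos h 2)]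
  norm_num
  rcases eq_or_ne z 0 with rfl | hz
  · simp
  have hz : 0 < ‖z‖ ^ 2 := by positivity
  rw [mul_assoc]
  gcongr
  calc (kN s z ^ 2)⁻¹ * ‖z‖ ^ 2 ≤ ((‖z‖ ^ 2) ^ 2)⁻¹ * ‖z‖ ^ 2 := by gcongr
    _ = _ := by field_simp

lemma norm_kS_le {s : ℝ} (hs : 0 < s) (z : ℂ) : ‖kS s z‖ ≤ ‖z‖⁻¹ := by
  rw [kS, norm_smul, RCLike.norm_conj, norm_inv, Real.norm_eq_abs, abs_of_pos (kN_pos hs z), kN_eq]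
  rcases eq_or_ne z 0 with rfl | hz
  · simp
  have hz : 0 < ‖z‖ := by positivity
  calc (‖z‖ ^ 2 + s ^ 2)⁻¹ * ‖z‖ ≤ (‖z‖ ^ 2)⁻¹ * ‖z‖ := by gcongr; nlinarith
    _ = _ := by field_simp

/-- integration by parts against a compactly supported function -/
lemma ibp {H g : ℂ → ℂ} (hH : ContDiff ℝ 1 H) (hc : HasCompactSupport H) (hg : ContDiff ℝ 1 g)
    (v : ℂ) : ∫ z, H z * dv v g z = - ∫ z, dv v H z * g z := by
  have h1 : Continuous (fun z => dv v H z) := (hH.continuous_fderiv one_ne_zero).clm_apply continuous_const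
  have h2 : Continuous (fun z => dv v g z) := (hg.continuous_fderiv one_ne_zero).clm_apply continuous_const
  have hc' : HasCompactSupport (fun z => dv v H z) := hc.fderiv_apply (𝕜 := ℝ) v
  apply integral_mul_fderiv_eq_neg_fderiv_mul_of_integrable
  · exact (h1.mul hg.continuous).integrable_of_hasCompactSupport hc'.mul_right
  · exact (hH.continuous.mul h2).integrable_of_hasCompactSupport hc.mul_right
  · exact (hH.continuous.mul hg.continuous).integrable_of_hasCompactSupport hc.mul_right
  · intro x _; exact hH.differentiable (by simp) x
  · intro x _; exact hg.differentiable (by simp) x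

/-- the peak functions -/
lemma peak : ∃ κ > 0, ∀ g : ℂ → ℂ, Continuous g → HasCompactSupport g →
    Tendsto (fun s : ℝ => ∫ z, ((2 * s ^ 2 / kN s z ^ 2 : ℝ) : ℂ) * g z) (𝓝[>] 0)
      (𝓝 ((κ : ℝ) * g 0)) := by
  have hIntg : Integrable (fun z : ℂ => ((1 + ‖z‖ ^ 2) ^ 2)⁻¹) := by
    have := integrable_rpow_neg_one_add_norm_sq (E := ℂ) (μ := volume) (r := 4) (by simp; norm_num)
    refine this.congr (Eventually.of_forall fun z => ?_)
    simp only
    rw [show (-4 / 2 : ℝ) = -(2 : ℕ) by norm_num, Real.rpow_neg (by positivity), Real.rpow_natCast]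
  set κ := ∫ z : ℂ, ((1 + ‖z‖ ^ 2) ^ 2)⁻¹ with hκ
  have hκpos : 0 < κ := by
    rw [hκ]
    apply (integral_pos_iff_support_of_nonneg (fun z => by positivity) hIntg).2
    have : (Function.support fun z : ℂ => ((1 + ‖z‖ ^ 2) ^ 2)⁻¹) = univ := by
      ext z; simp; positivity
    rw [this]; simp
  refine ⟨2 * κ, by positivity, fun g hg hgc => ?_⟩
  have key := tendsto_integral_comp_smul_smul_of_integrable (F := ℂ) (E := ℂ) (μ := volume)
    (φ := fun z => κ⁻¹ * ((1 + ‖z‖ ^ 2) ^ 2)⁻¹) (fun z => by positivity)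
    (by rw [integral_const_mul, ← hκ, inv_mul_cancel₀ hκpos.ne']) ?_
    (hg.integrable_of_hasCompactSupport hgc) hg.continuousAt
  · have k2 := (key.comp tendsto_inv_nhdsGT_zero).const_mul ((2 * κ : ℝ) : ℂ)
    refine k2.congr' ?_
    filter_upwards [self_mem_nhdsWithin] with s (hs : 0 < s)
    simp only [Function.comp]
    rw [← integral_const_mul]
    congr 1; ext z
    simp only [Complex.finrank_real_complex, kN_eq, Complex.real_smul]
    rw [← mul_assoc, ← Complex.ofReal_mul]
    congr 2
    rw [norm_mul, Complex.norm_real, norm_inv, Real.norm_eq_abs, abs_of_pos hs]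
    have : 0 < ‖z‖ ^ 2 + s ^ 2 := by positivity
    field_simp
    ring
  · simp only [Complex.finrank_real_complex]
    have h1 : Tendsto (fun z : ℂ => κ⁻¹ * (‖z‖ ^ 2)⁻¹) (Bornology.cobounded ℂ) (𝓝 (κ⁻¹ * 0)) := by
      apply Tendsto.const_mul
      exact (tendsto_inv_atTop_zero.comp ((tendsto_pow_atTop two_ne_zero).comp tendsto_norm_cobounded_atTop))
    rw [mul_zero] at h1
    refine squeeze_zero' (Eventually.of_forall fun z => by positivity) ?_ h1
    filter_upwards [tendsto_norm_cobounded_atTop.eventually_ge_atTop 1] with z hz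
    have h0 : 0 < ‖z‖ := by linarith
    rw [← mul_assoc, mul_comm _ κ⁻¹, mul_assoc]
    gcongr
    rw [← div_eq_mul_inv, inv_eq_one_div, div_le_div_iff₀ (by positivity) (by positivity)]
    nlinarith [sq_nonneg (‖z‖^2)]

def Dop (g : ℂ → ℂ) (z : ℂ) : ℂ := dv 1 g z + Complex.I * dv Complex.I g z
def Dbar (g : ℂ → ℂ) (z : ℂ) : ℂ := dv 1 g z - Complex.I * dv Complex.I g z

lemma dv_smooth {F : Type*} [NormedAddCommGroup F] [NormedSpace ℝ F] {g : ℂ → F}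
    (hg : ContDiff ℝ ∞ g) (v : ℂ) : ContDiff ℝ ∞ (dv v g) := by
  have : ContDiff ℝ ∞ (fderiv ℝ g) := hg.fderiv_right (by simp)
  exact this.clm_apply contDiff_const

lemma Dop_smooth {g : ℂ → ℂ} (hg : ContDiff ℝ ∞ g) : ContDiff ℝ ∞ (Dop g) :=
  (dv_smooth hg 1).add (contDiff_const.mul (dv_smooth hg _))

lemma Dbar_smooth {g : ℂ → ℂ} (hg : ContDiff ℝ ∞ g) : ContDiff ℝ ∞ (Dbar g) :=
  (dv_smooth hg 1).sub (contDiff_const.mul (dv_smooth hg _))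

lemma dv_compact {g : ℂ → ℂ} (hg : HasCompactSupport g) (v : ℂ) : HasCompactSupport (dv v g) :=
  hg.fderiv_apply (𝕜 := ℝ) v

lemma Dop_compact {g : ℂ → ℂ} (hg : HasCompactSupport g) : HasCompactSupport (Dop g) :=
  (dv_compact hg 1).add ((dv_compact hg _).mul_left)

lemma Dbar_compact {g : ℂ → ℂ} (hg : HasCompactSupport g) : HasCompactSupport (Dbar g) := by
  have := (dv_compact hg 1).add ((dv_compact hg Complex.I).mul_left (f := fun _ => -Complex.I))
  have e : Dbar g = dv 1 g + (fun _ => -Complex.I) * dv Complex.I g := by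
    ext z; simp [Dbar]; ring
  rw [e]; exact this

lemma dv_scale (g : ℂ → ℂ) (c : ℝ) (v z : ℂ) :
    dv v (fun z => g (c • z)) z = c • dv v g (c • z) := by
  simp only [dv]
  rw [fderiv_comp_smul]; rfl

lemma dv_const_smul (g : ℂ → ℂ) (hg : Differentiable ℝ g) (c : ℝ) (v z : ℂ) :
    dv v (fun z => c • g z) z = c • dv v g z := by
  simp only [dv]
  rw [fderiv_fun_const_smul (hg z)]; rfl

lemma dv_congr_of_ball {g : ℂ → ℂ} {R : ℝ} {c : ℂ} (h : ∀ z ∈ ball (0:ℂ) R, g z = c) (v : ℂ) :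
    ∀ z ∈ ball (0:ℂ) R, dv v g z = 0 := by
  intro z hz
  have : g =ᶠ[𝓝 z] fun _ => c := by
    filter_upwards [isOpen_ball.mem_nhds hz] with y hy using h y hy
  rw [dv, this.fderiv_eq]; simp

lemma cutoff : ∃ C > 0, ∀ L > 0, ∃ χ : ℂ → ℂ, ContDiff ℝ ∞ χ ∧ HasCompactSupport χ ∧
    (∀ z, ‖χ z‖ ≤ 1) ∧ χ 0 = 1 ∧ (∀ z ∉ ball (0:ℂ) (2 * L), χ z = 0) ∧
    (∀ z, ‖Dop χ z‖ ≤ C / L) ∧ (∀ z, ‖Dbar (Dop χ) z‖ ≤ C / L ^ 2) ∧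
    (∀ z ∈ ball (0:ℂ) L, Dop χ z = 0) ∧ (∀ z ∈ ball (0:ℂ) L, Dbar (Dop χ) z = 0) ∧
    (∀ z ∉ closedBall (0:ℂ) (2 * L), Dop χ z = 0) ∧
    (∀ z ∉ closedBall (0:ℂ) (2 * L), Dbar (Dop χ) z = 0) := by
  let b : ContDiffBump (0:ℂ) := ⟨1, 2, one_pos, one_lt_two⟩
  let c : ℂ → ℂ := fun z => ((b z : ℝ) : ℂ)
  have hc : ContDiff ℝ ∞ c := Complex.ofRealCLM.contDiff.comp b.contDiff
  have hcc : HasCompactSupport c := b.hasCompactSupport.comp_left (g := fun x : ℝ => (x : ℂ)) (by simp)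
  have h1 := (Dop_smooth hc)
  have h2 := (Dbar_smooth h1)
  obtain ⟨C1, hC1⟩ := (Dop_compact hcc).exists_bound_of_continuous h1.continuous
  obtain ⟨C2, hC2⟩ := (Dbar_compact (Dop_compact hcc)).exists_bound_of_continuous h2.continuous
  refine ⟨max 1 (max C1 C2), by positivity, fun L hL => ?_⟩
  have hs : ContDiff ℝ ∞ (fun z : ℂ => L⁻¹ • z) := by fun_prop
  have e1 : Dop (fun z => c (L⁻¹ • z)) = fun z => L⁻¹ • Dop c (L⁻¹ • z) := by
    ext z; simp only [Dop, dv_scale]; simp; ring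
  have e2 : Dbar (Dop (fun z => c (L⁻¹ • z))) = fun z => (L⁻¹) ^ 2 • Dbar (Dop c) (L⁻¹ • z) := by
    have h4 : Differentiable ℝ (fun z : ℂ => Dop c (L⁻¹ • z)) :=
      (h1.comp hs).differentiable (by simp)
    ext z; rw [e1]; simp only [Dbar]
    rw [dv_const_smul _ h4, dv_const_smul _ h4, dv_scale, dv_scale]; simp; ring
  have nrm : ∀ z : ℂ, ‖L⁻¹ • z‖ = ‖z‖ / L := by
    intro z; rw [norm_smul, norm_inv, Real.norm_eq_abs, abs_of_pos hL]; ring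
  have o1 : ∀ z ∈ ball (0:ℂ) L, c (L⁻¹ • z) = 1 := by
    intro z hz
    have : L⁻¹ • z ∈ closedBall (0:ℂ) b.rIn := by
      rw [mem_closedBall_zero_iff, nrm, div_le_one hL]
      exact (mem_ball_zero_iff.1 hz).le
    simp [c, -Complex.real_smul, b.one_of_mem_closedBall this]
  have o2 : ∀ z ∉ ball (0:ℂ) (2 * L), c (L⁻¹ • z) = 0 := by
    intro z hz
    have : b.rOut ≤ dist (L⁻¹ • z) 0 := by
      rw [dist_zero_right, nrm, le_div_iff₀ hL]
      rw [mem_ball_zero_iff, not_lt] at hz; exact hz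
    simp [c, -Complex.real_smul, b.zero_of_le_dist this]
  have oz : ∀ (g : ℂ → ℂ), (∀ z ∉ closedBall (0:ℂ) (2 * L), g z = 0) → ∀ v,
      ∀ z ∉ closedBall (0:ℂ) (2 * L), dv v g z = 0 := by
    intro g hg v z hz
    have : g =ᶠ[𝓝 z] fun _ => 0 := by
      filter_upwards [isClosed_closedBall.isOpen_compl.mem_nhds hz] with y hy using hg y hy
    rw [dv, this.fderiv_eq]; simp
  have p1 : ∀ z ∈ ball (0:ℂ) L, Dop (fun z => c (L⁻¹ • z)) z = 0 := fun z hz => by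
    simp [Dop, -Complex.real_smul, dv_congr_of_ball o1 _ z hz]
  have p2 : ∀ z ∉ closedBall (0:ℂ) (2 * L), Dop (fun z => c (L⁻¹ • z)) z = 0 := fun z hz => by
    have := oz (fun z => c (L⁻¹ • z)) (fun z hz => o2 z (fun h => hz (ball_subset_closedBall h)))
    simp [Dop, -Complex.real_smul, this _ z hz]
  refine ⟨fun z => c (L⁻¹ • z), hc.comp hs, ?_, ?_, ?_, o2, ?_, ?_, p1, ?_, p2, ?_⟩
  · apply HasCompactSupport.intro (isCompact_closedBall (0:ℂ) (2 * L))
    exact fun z hz => o2 z (fun h => hz (ball_subset_closedBall h))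
  · intro z
    simp only [c, Complex.norm_real, Real.norm_eq_abs, abs_of_nonneg b.nonneg]
    exact b.le_one
  · exact o1 0 (by simpa using hL)
  · intro z; rw [e1]
    simp only
    rw [nrm]
    gcongr
    exact (hC1 _).trans (by simp)
  · intro z; rw [e2]
    simp only
    rw [norm_smul, norm_pow, norm_inv, Real.norm_eq_abs, abs_of_pos hL, inv_pow, inv_mul_eq_div]
    gcongr
    exact (hC2 _).trans (by simp)
  · intro z hz
    simp only [Dbar, dv_congr_of_ball p1 _ z hz, mul_zero, sub_zero]
  · intro z hz
    simp only [Dbar, oz _ p2 _ z hz, mul_zero, sub_zero]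

lemma inv_norm_ball {δ : ℝ} (hδ : 0 < δ) :
    Integrable (fun z : ℂ => (Iio δ).indicator (fun y : ℝ => y⁻¹) ‖z‖) ∧
    ∫ z : ℂ, (Iio δ).indicator (fun y : ℝ => y⁻¹) ‖z‖ = 2 * (volume.real (ball (0:ℂ) 1)) * δ := by
  have e : ∀ y ∈ Ioi (0:ℝ), y ^ (Module.finrank ℝ ℂ - 1) • (Iio δ).indicator (fun y : ℝ => y⁻¹) y
      = (Iio δ).indicator (fun _ => (1:ℝ)) y := by
    intro y (hy : 0 < y)
    simp only [Complex.finrank_real_complex]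
    by_cases h : y ∈ Iio δ
    · simp only [indicator_of_mem h]; simp [hy.ne']
    · simp [indicator_of_notMem h]
  constructor
  · rw [integrable_fun_norm_addHaar, integrableOn_congr_fun e measurableSet_Ioi]
    rw [IntegrableOn, integrable_indicator_iff measurableSet_Iio, IntegrableOn,
      Measure.restrict_restrict measurableSet_Iio]
    apply integrableOn_const
    · rw [inter_comm, Ioi_inter_Iio]; simp
    · simp
  · rw [integral_fun_norm_addHaar, setIntegral_congr_fun measurableSet_Ioi e,
      integral_indicator measurableSet_Iio, Measure.restrict_restrict measurableSet_Iio,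
      inter_comm, Ioi_inter_Iio]
    simp [hδ.le]; ring

lemma near_bound {F : ℂ → ℝ} (hF : Continuous F) {B M δ R : ℝ} (hδ : 0 < δ) (hB : 0 ≤ B)
    (hFB : ∀ᵐ z, |F z| ≤ B) (hM : ∫ z in ball (0:ℂ) R, |F z| ≤ M) :
    IntegrableOn (fun z : ℂ => ‖z‖⁻¹ * |F z|) (ball 0 R) ∧
    ∫ z in ball (0:ℂ) R, ‖z‖⁻¹ * |F z| ≤
      2 * (volume.real (ball (0:ℂ) 1)) * B * δ + M / δ := by
  obtain ⟨i1, i2⟩ := inv_norm_ball hδ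
  have i3 : IntegrableOn (fun z => |F z|) (ball (0:ℂ) R) :=
    (hF.abs.continuousOn.integrableOn_compact (isCompact_closedBall 0 R)).mono_set
      ball_subset_closedBall
  have i4 : IntegrableOn (fun z : ℂ => B * (Iio δ).indicator (fun y : ℝ => y⁻¹) ‖z‖ + δ⁻¹ * |F z|)
      (ball 0 R) := (i1.integrableOn.const_mul B).add (i3.const_mul _)
  have hle : ∀ᵐ z ∂(volume.restrict (ball (0:ℂ) R)), ‖z‖⁻¹ * |F z| ≤
      B * (Iio δ).indicator (fun y : ℝ => y⁻¹) ‖z‖ + δ⁻¹ * |F z| := by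
    filter_upwards [ae_restrict_of_ae hFB] with z hz
    by_cases h : ‖z‖ ∈ Iio δ
    · rw [indicator_of_mem h]
      have : ‖z‖⁻¹ * |F z| ≤ ‖z‖⁻¹ * B := by gcongr
      have : 0 ≤ δ⁻¹ * |F z| := by positivity
      linarith
    · rw [indicator_of_notMem h]
      have h' : δ ≤ ‖z‖ := by simpa using h
      have : ‖z‖⁻¹ * |F z| ≤ δ⁻¹ * |F z| := by gcongr
      linarith
  have hm : AEStronglyMeasurable (fun z : ℂ => ‖z‖⁻¹ * |F z|) (volume.restrict (ball 0 R)) :=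
    ((measurable_norm.inv).mul hF.abs.measurable).aestronglyMeasurable
  constructor
  · refine Integrable.mono' i4 hm ?_
    filter_upwards [hle] with z hz
    rw [Real.norm_eq_abs, abs_of_nonneg (by positivity)]; exact hz
  · calc _ ≤ ∫ z in ball (0:ℂ) R, (B * (Iio δ).indicator (fun y : ℝ => y⁻¹) ‖z‖ + δ⁻¹ * |F z|) := by
          exact integral_mono_of_nonneg (Eventually.of_forall fun z => by positivity) i4 hle
      _ = B * (∫ z in ball (0:ℂ) R, (Iio δ).indicator (fun y : ℝ => y⁻¹) ‖z‖)
          + δ⁻¹ * ∫ z in ball (0:ℂ) R, |F z| := by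
          rw [integral_add (i1.integrableOn.const_mul B) (i3.const_mul _), integral_const_mul,
            integral_const_mul]
      _ ≤ B * (2 * (volume.real (ball (0:ℂ) 1)) * δ) + δ⁻¹ * M := by
          gcongr
          rw [← i2]
          apply setIntegral_le_integral i1
          refine Eventually.of_forall fun z => ?_
          simp only [Pi.zero_apply]
          by_cases h : ‖z‖ ∈ Iio δ
          · rw [indicator_of_mem h]; positivity
          · rw [indicator_of_notMem h]
      _ = _ := by rw [div_eq_mul_inv]; ring

/-- Laplacian in `ℂ`. -/
def lapC (w : ℂ → ℝ) (z : ℂ) : ℝ := dv 1 (dv 1 w) z + dv Complex.I (dv Complex.I w) z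

/-- (conjugate) gradient in `ℂ` -/
def gradC (w : ℂ → ℝ) (z : ℂ) : ℂ := ((dv 1 w z : ℝ) : ℂ) - Complex.I * ((dv Complex.I w z : ℝ) : ℂ)

lemma dv_mul {f g : ℂ → ℂ} (hf : ContDiff ℝ ∞ f) (hg : ContDiff ℝ ∞ g) (v z : ℂ) :
    dv v (fun z => f z * g z) z = dv v f z * g z + f z * dv v g z := by
  simp only [dv]
  rw [fderiv_fun_mul (hf.differentiable (by simp) z) (hg.differentiable (by simp) z)]
  simp; ring

lemma dv_ofReal {g : ℂ → ℝ} {z : ℂ} (hg : DifferentiableAt ℝ g z) (v : ℂ) :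
    dv v (fun z => ((g z : ℝ) : ℂ)) z = ((dv v g z : ℝ) : ℂ) := by
  simp only [dv]
  have := (Complex.ofRealCLM.hasFDerivAt (x := g z)).comp z hg.hasFDerivAt
  have h2 : HasFDerivAt (fun z => ((g z : ℝ) : ℂ)) _ z := this
  rw [h2.fderiv]; simp

lemma dv_comm {w : ℂ → ℝ} {z : ℂ} (hw : ContDiffAt ℝ ∞ w z) (u v : ℂ) :
    dv v (dv u w) z = dv u (dv v w) z := by
  have hd : DifferentiableAt ℝ (fderiv ℝ w) z :=
    (hw.fderiv_right (m := ∞) (by simp)).differentiableAt (by simp)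
  have h1 : ∀ u v : ℂ, dv v (dv u w) z = fderiv ℝ (fderiv ℝ w) z v u := by
    intro u v
    have : HasFDerivAt (dv u w) _ z := hd.hasFDerivAt.clm_apply (hasFDerivAt_const u z)
    rw [dv, this.fderiv]; simp
  rw [h1, h1]
  exact (hw.isSymmSndFDerivAt (by simp; exact WithTop.coe_le_coe.2 (le_top : (2:ℕ∞) ≤ ⊤))) v u

lemma Dop_mul {f g : ℂ → ℂ} (hf : ContDiff ℝ ∞ f) (hg : ContDiff ℝ ∞ g) (z : ℂ) :
    Dop (fun z => f z * g z) z = Dop f z * g z + f z * Dop g z := by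
  simp only [Dop, dv_mul hf hg]; ring

lemma Dbar_mul {f g : ℂ → ℂ} (hf : ContDiff ℝ ∞ f) (hg : ContDiff ℝ ∞ g) (z : ℂ) :
    Dbar (fun z => f z * g z) z = Dbar f z * g z + f z * Dbar g z := by
  simp only [Dbar, dv_mul hf hg]; ring

lemma ofReal_smooth {w : ℂ → ℝ} (hw : ContDiff ℝ ∞ w) :
    ContDiff ℝ ∞ (fun z => ((w z : ℝ) : ℂ)) := Complex.ofRealCLM.contDiff.comp hw

lemma gradC_smooth {w : ℂ → ℝ} (hw : ContDiff ℝ ∞ w) : ContDiff ℝ ∞ (gradC w) :=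
  (ofReal_smooth (dv_smooth hw 1)).sub (contDiff_const.mul (ofReal_smooth (dv_smooth hw _)))

lemma lapC_smooth {w : ℂ → ℝ} (hw : ContDiff ℝ ∞ w) : ContDiff ℝ ∞ (lapC w) :=
  (dv_smooth (dv_smooth hw 1) 1).add (dv_smooth (dv_smooth hw _) _)

lemma Dop_gradC {w : ℂ → ℝ} (hw : ContDiff ℝ ∞ w) (z : ℂ) :
    Dop (gradC w) z = ((lapC w z : ℝ) : ℂ) := by
  have h1 := (dv_smooth hw 1).differentiable (by simp)
  have h2 := (dv_smooth hw Complex.I).differentiable (by simp)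
  have key : ∀ v, dv v (gradC w) z = ((dv v (dv 1 w) z : ℝ) : ℂ)
      - Complex.I * ((dv v (dv Complex.I w) z : ℝ) : ℂ) := by
    intro v
    rw [← dv_ofReal (h1 z), ← dv_ofReal (h2 z)]
    have a1 : DifferentiableAt ℝ (fun z => ((dv 1 w z : ℝ) : ℂ)) z :=
      (ofReal_smooth (dv_smooth hw 1)).differentiable (by simp) z
    have a2 : DifferentiableAt ℝ (fun z => ((dv Complex.I w z : ℝ) : ℂ)) z :=
      (ofReal_smooth (dv_smooth hw Complex.I)).differentiable (by simp) z
    have : HasFDerivAt (gradC w) _ z := a1.hasFDerivAt.sub (a2.hasFDerivAt.const_mul Complex.I)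
    simp only [dv] at this ⊢
    rw [this.fderiv]; simp
  rw [Dop, key, key, dv_comm hw.contDiffAt 1 Complex.I]
  simp only [lapC]; push_cast
  linear_combination (-((dv Complex.I (dv Complex.I w) z : ℝ) : ℂ)) * Complex.I_mul_I

lemma ibp_D {H g : ℂ → ℂ} (hH : ContDiff ℝ ∞ H) (hc : HasCompactSupport H) (hg : ContDiff ℝ ∞ g) :
    ∫ z, H z * Dop g z = - ∫ z, Dop H z * g z := by
  have H1 := hH.of_le (m := 1) (by simp)
  have g1 := hg.of_le (m := 1) (by simp)
  have i1 : ∀ v, Integrable (fun z => H z * dv v g z) := fun v =>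
    (hH.continuous.mul (dv_smooth hg v).continuous).integrable_of_hasCompactSupport hc.mul_right
  have i2 : ∀ v, Integrable (fun z => dv v H z * g z) := fun v =>
    ((dv_smooth hH v).continuous.mul hg.continuous).integrable_of_hasCompactSupport
      (dv_compact hc v).mul_right
  have e1 : ∀ z, H z * Dop g z = H z * dv 1 g z + Complex.I * (H z * dv Complex.I g z) := by
    intro z; simp only [Dop]; ring
  have e2 : ∀ z, Dop H z * g z = dv 1 H z * g z + Complex.I * (dv Complex.I H z * g z) := by
    intro z; simp only [Dop]; ring
  simp only [e1, e2]
  rw [integral_add (i1 _) ((i1 _).const_mul _), integral_add (i2 _) ((i2 _).const_mul _),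
    integral_const_mul, integral_const_mul, ibp H1 hc g1, ibp H1 hc g1]; ring

lemma ibp_Dbar {H g : ℂ → ℂ} (hH : ContDiff ℝ ∞ H) (hc : HasCompactSupport H)
    (hg : ContDiff ℝ ∞ g) :
    ∫ z, H z * Dbar g z = - ∫ z, Dbar H z * g z := by
  have H1 := hH.of_le (m := 1) (by simp)
  have g1 := hg.of_le (m := 1) (by simp)
  have i1 : ∀ v, Integrable (fun z => H z * dv v g z) := fun v =>
    (hH.continuous.mul (dv_smooth hg v).continuous).integrable_of_hasCompactSupport hc.mul_right
  have i2 : ∀ v, Integrable (fun z => dv v H z * g z) := fun v =>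
    ((dv_smooth hH v).continuous.mul hg.continuous).integrable_of_hasCompactSupport
      (dv_compact hc v).mul_right
  have e1 : ∀ z, H z * Dbar g z = H z * dv 1 g z - Complex.I * (H z * dv Complex.I g z) := by
    intro z; simp only [Dbar]; ring
  have e2 : ∀ z, Dbar H z * g z = dv 1 H z * g z - Complex.I * (dv Complex.I H z * g z) := by
    intro z; simp only [Dbar]; ring
  simp only [e1, e2]
  rw [integral_sub (i1 _) ((i1 _).const_mul _), integral_sub (i2 _) ((i2 _).const_mul _),
    integral_const_mul, integral_const_mul, ibp H1 hc g1, ibp H1 hc g1]; ring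

lemma grad_at_zero : ∃ κ > 0, ∃ C > 0, ∀ L > 0, ∀ w : ℂ → ℝ, ContDiff ℝ ∞ w →
    ∀ S B M δ : ℝ, 0 < δ → 0 ≤ B → (∀ z, |w z - w 0| ≤ S) → (∀ᵐ z, |lapC w z| ≤ B) →
    (∫ z in ball (0:ℂ) (2 * L), |lapC w z| ≤ M) →
    κ * ‖gradC w 0‖ ≤ C * (B * δ) + M / δ + C / L * S := by
  obtain ⟨κ, hκ, hpeak⟩ := peak
  obtain ⟨C, hC, hcut⟩ := cutoff
  set β := volume.real (ball (0:ℂ) 1) with hβ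
  have hβ0 : 0 ≤ β := measureReal_nonneg
  refine ⟨κ, hκ, 2 * β + 12 * π * C, by positivity, ?_⟩
  intro L hL w hw S B M δ hδ hB hS hlap hM
  obtain ⟨χ, hχ, hχc, hχ1, hχ0, hχout, hD, hDD, hDin, hDDin, hDout, hDDout⟩ := hcut L hL
  have hS0 : 0 ≤ S := (abs_nonneg _).trans (hS 0)
  obtain ⟨n1, n2⟩ := near_bound (lapC_smooth hw).continuous hδ hB hlap hM
  set φ := gradC w with hφ
  have hφs : ContDiff ℝ ∞ φ := gradC_smooth hw
  have key : ∀ s > 0, ‖∫ z, ((2 * s ^ 2 / kN s z ^ 2 : ℝ) : ℂ) * (χ z * φ z)‖ ≤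
      (2 * β * B * δ + M / δ) + 12 * π * C / L * S := by
    intro s hs
    have hk := kS_smooth hs
    have hH : ContDiff ℝ ∞ (fun z => kS s z * χ z) := hk.mul hχ
    have hHc : HasCompactSupport (fun z => kS s z * χ z) := hχc.mul_left
    have hX := Dop_smooth hχ
    have hH2 : ContDiff ℝ ∞ (fun z => kS s z * Dop χ z) := hk.mul hX
    have hH2c : HasCompactSupport (fun z => kS s z * Dop χ z) := (Dop_compact hχc).mul_left
    have hwc : ContDiff ℝ ∞ (fun z => ((w z - w 0 : ℝ) : ℂ)) :=
      ofReal_smooth (hw.sub contDiff_const)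
    have ewc : ∀ z, Dbar (fun z => ((w z - w 0 : ℝ) : ℂ)) z = φ z := by
      intro z
      have hdd : DifferentiableAt ℝ (fun z => w z - w 0) z :=
        (hw.sub contDiff_const).differentiable (by simp) z
      have : ∀ v, dv v (fun z => w z - w 0) z = dv v w z := by
        intro v; simp only [dv]; rw [fderiv_sub_const]
      rw [Dbar, dv_ofReal hdd, dv_ofReal hdd, this, this, hφ, gradC]
    have I1 := ibp_D hH hHc hφs
    have I2 := ibp_Dbar hH2 hH2c hwc
    simp only [ewc] at I2
    have eD : ∀ z, Dop (fun z => kS s z * χ z) z * φ z =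
        ((2 * s ^ 2 / kN s z ^ 2 : ℝ) : ℂ) * (χ z * φ z) + kS s z * Dop χ z * φ z := by
      intro z
      rw [Dop_mul hk hχ, show Dop (kS s) z = ((2 * s ^ 2 / kN s z ^ 2 : ℝ) : ℂ) from D_kS hs z]
      ring
    simp only [eD] at I1
    have c1 : Continuous (fun z => ((2 * s ^ 2 / kN s z ^ 2 : ℝ) : ℂ)) := by
      apply Complex.continuous_ofReal.comp
      exact continuous_const.div ((kN_smooth s).continuous.pow 2)
        (fun z => pow_ne_zero 2 (kN_pos hs z).ne')
    rw [integral_add] at I1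
    rotate_left
    · exact (c1.mul (hχ.continuous.mul hφs.continuous)).integrable_of_hasCompactSupport
        (hχc.mul_right.mul_left)
    · exact (hH2.continuous.mul hφs.continuous).integrable_of_hasCompactSupport hH2c.mul_right
    have e : ∫ z, ((2 * s ^ 2 / kN s z ^ 2 : ℝ) : ℂ) * (χ z * φ z) =
        - (∫ z, kS s z * χ z * Dop φ z)
        + ∫ z, Dbar (fun z => kS s z * Dop χ z) z * ((w z - w 0 : ℝ) : ℂ) := by
      rw [I2] at I1
      linear_combination I1
    rw [e]
    refine (norm_add_le _ _).trans (add_le_add ?_ ?_)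
    · rw [norm_neg]
      refine le_trans ?_ n2
      rw [← integral_indicator measurableSet_ball]
      apply norm_integral_le_of_norm_le (n1.integrable_indicator measurableSet_ball)
      refine Eventually.of_forall fun z => ?_
      by_cases hz : z ∈ ball (0:ℂ) (2 * L)
      · rw [indicator_of_mem hz, hφ, Dop_gradC hw, norm_mul, norm_mul, Complex.norm_real,
          Real.norm_eq_abs]
        gcongr
        calc ‖kS s z‖ * ‖χ z‖ ≤ ‖z‖⁻¹ * 1 := by gcongr; exacts [norm_kS_le hs z, hχ1 z]
          _ = _ := mul_one _
      · rw [indicator_of_notMem hz, hχout z hz]; simp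
    · have hpt : ∀ z, ‖Dbar (fun z => kS s z * Dop χ z) z * ((w z - w 0 : ℝ) : ℂ)‖ ≤
          (closedBall (0:ℂ) (2 * L)).indicator (fun _ => 3 * C / L ^ 3 * S) z := by
        intro z
        rw [Dbar_mul hk hX]
        by_cases hz : z ∈ closedBall (0:ℂ) (2 * L)
        · rw [indicator_of_mem hz, norm_mul, Complex.norm_real, Real.norm_eq_abs]
          gcongr
          · by_cases hz2 : z ∈ ball (0:ℂ) L
            · rw [hDin z hz2, hDDin z hz2]; simp; positivity
            · have hzL : L ≤ ‖z‖ := by simpa using hz2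
              have b1 : ‖Dbar (kS s) z‖ ≤ 2 * (L ^ 2)⁻¹ :=
                (Dbar_kS hs z).trans (by gcongr)
              have b2 : ‖kS s z‖ ≤ L⁻¹ := (norm_kS_le hs z).trans (by gcongr)
              calc _ ≤ ‖Dbar (kS s) z‖ * ‖Dop χ z‖ + ‖kS s z‖ * ‖Dbar (Dop χ) z‖ := by
                    refine (norm_add_le _ _).trans ?_
                    rw [norm_mul, norm_mul]
                _ ≤ 2 * (L ^ 2)⁻¹ * (C / L) + L⁻¹ * (C / L ^ 2) := by
                    gcongr; exacts [hD z, hDD z]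
                _ = _ := by field_simp; ring
          · exact hS z
        · rw [indicator_of_notMem hz, hDout z hz, hDDout z hz]; simp
      have hvol : volume (closedBall (0:ℂ) (2 * L)) ≠ ⊤ := measure_closedBall_lt_top.ne
      refine (norm_integral_le_of_norm_le ?_ (Eventually.of_forall hpt)).trans ?_
      · exact (integrableOn_const hvol).integrable_indicator measurableSet_closedBall
      · rw [integral_indicator measurableSet_closedBall, setIntegral_const, Measure.real,
          Complex.volume_closedBall]
        simp only [ENNReal.toReal_mul, ENNReal.toReal_pow, smul_eq_mul]
        rw [ENNReal.toReal_ofReal (by positivity)]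
        simp
        apply le_of_eq; field_simp; ring
  have ht := hpeak (fun z => χ z * φ z) (hχ.continuous.mul hφs.continuous) hχc.mul_right
  have := le_of_tendsto ht.norm (eventually_nhdsWithin_of_forall (fun s hs => key s hs))
  rw [hχ0, one_mul, norm_mul, Complex.norm_real, Real.norm_eq_abs, abs_of_pos hκ] at this
  refine this.trans ?_
  have t1 : 0 ≤ 12 * π * C * (B * δ) := by positivity
  have t2 : 0 ≤ 2 * β / L * S := by positivity
  have : (2 * β + 12 * π * C) / L * S = 2 * β / L * S + 12 * π * C / L * S := by ring
  rw [this]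
  nlinarith

/-- double periodicity on `ℂ` -/
def PerC {F : Type*} (g : ℂ → F) : Prop := ∀ z, g (z + 1) = g z ∧ g (z + Complex.I) = g z

/-- closed unit cell -/
def cellK : Set ℂ := Icc (0:ℝ) 1 ×ℂ Icc (0:ℝ) 1

lemma PerC.int {F : Type*} {g : ℂ → F} (h : PerC g) (m n : ℤ) (z : ℂ) :
    g (z + m + n * Complex.I) = g z := by
  have h1 : Function.Periodic g 1 := fun z => (h z).1
  have h2 : Function.Periodic g Complex.I := fun z => (h z).2
  rw [h2.int_mul n]
  simpa using h1.int_mul m z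

lemma exists_cell (z : ℂ) : ∃ m n : ℤ, z + m + n * Complex.I ∈ cellK := by
  refine ⟨-⌊z.re⌋, -⌊z.im⌋, ?_⟩
  simp only [cellK, Complex.mem_reProdIm]
  simp
  refine ⟨⟨Int.floor_le _, ?_⟩, Int.floor_le _, ?_⟩
  · linarith [Int.lt_floor_add_one z.re]
  · linarith [Int.lt_floor_add_one z.im]

lemma cellK_compact : IsCompact cellK := isCompact_Icc.reProdIm isCompact_Icc

lemma cellK_nonempty : cellK.Nonempty := ⟨0, by simp [cellK, Complex.mem_reProdIm]⟩

lemma PerC.exists_max {g : ℂ → ℝ} (h : PerC g) (hc : Continuous g) : ∃ z0, ∀ z, g z ≤ g z0 := by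
  obtain ⟨z0, -, h0⟩ := cellK_compact.exists_isMaxOn cellK_nonempty hc.continuousOn
  refine ⟨z0, fun z => ?_⟩
  obtain ⟨m, n, hm⟩ := exists_cell z
  rw [← h.int m n z]
  exact h0 hm

lemma dv_shift {F : Type*} [NormedAddCommGroup F] [NormedSpace ℝ F] (g : ℂ → F) (y v z : ℂ) :
    dv v (fun z => g (y + z)) z = dv v g (y + z) := by
  simp only [dv]; rw [fderiv_comp_add_left]

lemma PerC.dv {F : Type*} [NormedAddCommGroup F] [NormedSpace ℝ F] {g : ℂ → F} (h : PerC g)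
    (v : ℂ) : PerC (dv v g) := by
  intro z
  have e1 : (fun z => g (1 + z)) = g := by funext z; rw [add_comm]; exact (h z).1
  have e2 : (fun z => g (Complex.I + z)) = g := by funext z; rw [add_comm]; exact (h z).2
  constructor
  · rw [add_comm, ← dv_shift, e1]
  · rw [add_comm, ← dv_shift, e2]

lemma PerC.gradC {w : ℂ → ℝ} (h : PerC w) : PerC (gradC w) := by
  intro z
  simp only [_root_.gradC]
  constructor
  · rw [(h.dv 1 z).1, (h.dv _ z).1]
  · rw [(h.dv 1 z).2, (h.dv _ z).2]

lemma PerC.lapC {w : ℂ → ℝ} (h : PerC w) : PerC (lapC w) := by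
  intro z
  simp only [_root_.lapC]
  constructor
  · rw [((h.dv 1).dv 1 z).1, ((h.dv _).dv _ z).1]
  · rw [((h.dv 1).dv 1 z).2, ((h.dv _).dv _ z).2]

lemma fderiv_eq_gradC (w : ℂ → ℝ) (z v : ℂ) : fderiv ℝ w z v = (gradC w z * v).re := by
  have : v = v.re • (1:ℂ) + v.im • Complex.I := by
    apply Complex.ext <;> simp
  conv_lhs => rw [this]
  rw [map_add, map_smul, map_smul]
  simp [gradC, dv]
  ring

lemma norm_fderiv_le (w : ℂ → ℝ) (z : ℂ) : ‖fderiv ℝ w z‖ ≤ ‖gradC w z‖ := by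
  refine ContinuousLinearMap.opNorm_le_bound _ (norm_nonneg _) fun v => ?_
  rw [fderiv_eq_gradC, ← norm_mul]
  exact Complex.abs_re_le_norm _

lemma osc_le {w : ℂ → ℝ} (hw : ContDiff ℝ ∞ w) (hp : PerC w) {G : ℝ}
    (hG : ∀ z, ‖gradC w z‖ ≤ G) (x y : ℂ) : |w x - w y| ≤ G * 2 := by
  obtain ⟨m, n, h1⟩ := exists_cell x
  obtain ⟨m', n', h2⟩ := exists_cell y
  rw [← hp.int m n x, ← hp.int m' n' y]
  set a := x + m + n * Complex.I
  set b := y + m' + n' * Complex.I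
  have := (convex_univ (𝕜 := ℝ) (E := ℂ)).norm_image_sub_le_of_norm_fderiv_le (f := w) (C := G)
    (fun z _ => hw.differentiable (by simp) z) (fun z _ => (norm_fderiv_le w z).trans (hG z))
    (mem_univ b) (mem_univ a)
  rw [Real.norm_eq_abs] at this
  refine this.trans ?_
  have hG0 : 0 ≤ G := (norm_nonneg _).trans (hG 0)
  gcongr
  simp only [cellK, Complex.mem_reProdIm, mem_Icc] at h1 h2
  refine (Complex.norm_le_abs_re_add_abs_im _).trans ?_
  have e1 : |(a - b).re| ≤ 1 := by rw [Complex.sub_re, abs_le]; constructor <;> linarith [h1.1.1, h1.1.2, h2.1.1, h2.1.2]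
  have e2 : |(a - b).im| ≤ 1 := by rw [Complex.sub_im, abs_le]; constructor <;> linarith [h1.2.1, h1.2.2, h2.2.1, h2.2.2]
  linarith

lemma grad_bound : ∃ C > 0, ∃ L > 0, ∀ w : ℂ → ℝ, ContDiff ℝ ∞ w → PerC w →
    ∀ B M δ : ℝ, 0 < δ → 0 ≤ B → (∀ᵐ z, |lapC w z| ≤ B) →
    (∀ y, ∫ z in ball (y:ℂ) (2 * L), |lapC w z| ≤ M) →
    ∀ z, ‖gradC w z‖ ≤ C * (B * δ + M / δ) := by
  obtain ⟨κ, hκ, C, hC, H⟩ := grad_at_zero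
  refine ⟨2 / κ * (C + 1), by positivity, 4 * C / κ, by positivity, ?_⟩
  intro w hw hp B M δ hδ hB hl hM
  have hgp : PerC (fun z => ‖gradC w z‖) := fun z => by
    simp only [(hp.gradC z).1, (hp.gradC z).2, and_self]
  obtain ⟨y, hy⟩ := hgp.exists_max (gradC_smooth hw).continuous.norm
  have hM0 : 0 ≤ M := le_trans (by positivity) (hM 0)
  set w' : ℂ → ℝ := fun z => w (y + z) with hw'
  have hs : ContDiff ℝ ∞ w' := hw.comp (contDiff_const.add contDiff_id)
  have e1 : ∀ v, dv v w' = fun z => dv v w (y + z) := fun v => by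
    funext z; exact dv_shift w y v z
  have el : ∀ z, lapC w' z = lapC w (y + z) := by
    intro z; simp only [lapC, e1, dv_shift]
  have eg : gradC w' 0 = gradC w y := by simp [gradC, e1]
  have := H (4 * C / κ) (by positivity) w' hs (‖gradC w y‖ * 2) B M δ hδ hB
    (fun z => osc_le hw hp hy _ _) ?_ ?_
  · rw [eg] at this
    have e : C / (4 * C / κ) * (‖gradC w y‖ * 2) = κ * ‖gradC w y‖ / 2 := by
      field_simp; ring
    rw [e] at this
    intro z
    refine (hy z).trans ?_
    have h3 : κ * ‖gradC w y‖ ≤ 2 * (C * (B * δ) + M / δ) := by linarith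
    have h4 : ‖gradC w y‖ ≤ 2 / κ * (C * (B * δ) + M / δ) := by
      rw [div_mul_eq_mul_div, le_div_iff₀ hκ]; linarith
    refine h4.trans ?_
    rw [mul_assoc]
    have t1 : 0 ≤ M / δ := by positivity
    have t2 : 0 ≤ B * δ := by positivity
    gcongr
    nlinarith
  · simp only [el]
    exact (measurePreserving_add_left volume y).quasiMeasurePreserving.ae hl
  · simp only [el]
    refine le_trans (le_of_eq ?_) (hM y)
    have := (measurePreserving_add_left volume y).setIntegral_preimage_emb
      (measurableEmbedding_addLeft y) (fun z => |lapC w z|) (ball y (2 * (4 * C / κ)))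
    rw [← this]
    congr 2
    ext z; simp

/-- integral over the unit cell -/
def cellInt (g : ℂ → ℝ) : ℝ := ∫ x in (0:ℝ)..1, ∫ y in (0:ℝ)..1, g ⟨x, y⟩

lemma cont_mk : Continuous (fun p : ℝ × ℝ => (⟨p.1, p.2⟩ : ℂ)) :=
  Complex.equivRealProdCLM.symm.continuous

lemma cont_mk2 {g : ℂ → ℝ} (hg : Continuous g) (x : ℝ) : Continuous (fun y : ℝ => g ⟨x, y⟩) :=
  hg.comp (cont_mk.comp (continuous_const.prodMk continuous_id))

lemma cont_mk1 {g : ℂ → ℝ} (hg : Continuous g) (y : ℝ) : Continuous (fun x : ℝ => g ⟨x, y⟩) :=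
  hg.comp (cont_mk.comp (continuous_id.prodMk continuous_const))

lemma cont_inner {g : ℂ → ℝ} (hg : Continuous g) (a b : ℝ) :
    Continuous (fun x : ℝ => ∫ y in a..b, g ⟨x, y⟩) :=
  intervalIntegral.continuous_parametric_intervalIntegral_of_continuous'
    (f := fun x y => g ⟨x, y⟩) (hg.comp cont_mk) a b

lemma ci_add {f g : ℂ → ℝ} (hf : Continuous f) (hg : Continuous g) :
    cellInt (fun z => f z + g z) = cellInt f + cellInt g := by
  simp only [cellInt]
  rw [← intervalIntegral.integral_add ((cont_inner hf 0 1).intervalIntegrable _ _)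
    ((cont_inner hg 0 1).intervalIntegrable _ _)]
  congr 1; funext x
  rw [intervalIntegral.integral_add ((cont_mk2 hf x).intervalIntegrable _ _)
    ((cont_mk2 hg x).intervalIntegrable _ _)]

lemma ci_const (c : ℝ) : cellInt (fun _ => c) = c := by simp [cellInt]

lemma ci_neg (f : ℂ → ℝ) : cellInt (fun z => - f z) = - cellInt f := by
  simp [cellInt]

lemma ci_mono {f g : ℂ → ℝ} (hf : Continuous f) (hg : Continuous g) (h : ∀ z, f z ≤ g z) :
    cellInt f ≤ cellInt g := by
  apply intervalIntegral.integral_mono_on zero_le_one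
    ((cont_inner hf 0 1).intervalIntegrable _ _) ((cont_inner hg 0 1).intervalIntegrable _ _)
  intro x _
  exact intervalIntegral.integral_mono_on zero_le_one ((cont_mk2 hf x).intervalIntegrable _ _)
    ((cont_mk2 hg x).intervalIntegrable _ _) (fun y _ => h _)

lemma hasDeriv_im {g : ℂ → ℝ} (hg : ContDiff ℝ ∞ g) (x y : ℝ) :
    HasDerivAt (fun y : ℝ => g ⟨x, y⟩) (dv Complex.I g ⟨x, y⟩) y := by
  have h1 : HasDerivAt (fun y : ℝ => (⟨x, y⟩ : ℂ)) Complex.I y := by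
    have h := ((Complex.ofRealCLM.hasDerivAt (x := y)).mul_const Complex.I).const_add (x:ℂ)
    have e : (fun y : ℝ => (⟨x, y⟩ : ℂ)) = fun y : ℝ => (x:ℂ) + Complex.ofRealCLM y * Complex.I := by
      funext y; apply Complex.ext <;> simp
    rw [e]; simpa using h
  exact (hg.differentiable (by simp) _).hasFDerivAt.comp_hasDerivAt y h1

lemma hasDeriv_re {g : ℂ → ℝ} (hg : ContDiff ℝ ∞ g) (x y : ℝ) :
    HasDerivAt (fun x : ℝ => g ⟨x, y⟩) (dv 1 g ⟨x, y⟩) x := by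
  have h1 : HasDerivAt (fun x : ℝ => (⟨x, y⟩ : ℂ)) 1 x := by
    have h := (Complex.ofRealCLM.hasDerivAt (x := x)).add_const ((y:ℂ) * Complex.I)
    have e : (fun x : ℝ => (⟨x, y⟩ : ℂ)) = fun x : ℝ => Complex.ofRealCLM x + (y:ℂ) * Complex.I := by
      funext y; apply Complex.ext <;> simp
    rw [e]; simpa using h
  exact (hg.differentiable (by simp) _).hasFDerivAt.comp_hasDerivAt x h1

lemma per_im {g : ℂ → ℝ} (hp : PerC g) (x y : ℝ) : g ⟨x, y + 1⟩ = g ⟨x, y⟩ := by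
  rw [← (hp ⟨x, y⟩).2]; congr 1; apply Complex.ext <;> simp

lemma per_re {g : ℂ → ℝ} (hp : PerC g) (x y : ℝ) : g ⟨x + 1, y⟩ = g ⟨x, y⟩ := by
  rw [← (hp ⟨x, y⟩).1]; congr 1; apply Complex.ext <;> simp

lemma ci_dvI {g : ℂ → ℝ} (hg : ContDiff ℝ ∞ g) (hp : PerC g) : cellInt (dv Complex.I g) = 0 := by
  have : ∀ x : ℝ, ∫ y in (0:ℝ)..1, dv Complex.I g ⟨x, y⟩ = 0 := by
    intro x
    rw [intervalIntegral.integral_eq_sub_of_hasDerivAt (fun y _ => hasDeriv_im hg x y)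
      ((cont_mk2 (dv_smooth hg _).continuous x).intervalIntegrable _ _)]
    have := per_im hp x 0
    rw [zero_add] at this; rw [this, sub_self]
  simp [cellInt, this]

lemma ci_swap {g : ℂ → ℝ} (hg : Continuous g) :
    cellInt g = ∫ y in (0:ℝ)..1, ∫ x in (0:ℝ)..1, g ⟨x, y⟩ := by
  rw [cellInt, MeasureTheory.intervalIntegral_intervalIntegral_swap]
  have hc : Continuous (Function.uncurry fun x y : ℝ => g ⟨x, y⟩) := hg.comp cont_mk
  have hK : IsCompact ((Icc (0:ℝ) 1) ×ˢ (Icc (0:ℝ) 1)) := isCompact_Icc.prod isCompact_Icc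
  refine (hc.continuousOn.integrableOn_compact hK).mono_set ?_
  rw [uIoc_of_le zero_le_one]
  exact prod_mono Ioc_subset_Icc_self Ioc_subset_Icc_self

lemma ci_dv1 {g : ℂ → ℝ} (hg : ContDiff ℝ ∞ g) (hp : PerC g) : cellInt (dv 1 g) = 0 := by
  have : ∀ y : ℝ, ∫ x in (0:ℝ)..1, dv 1 g ⟨x, y⟩ = 0 := by
    intro y
    rw [intervalIntegral.integral_eq_sub_of_hasDerivAt (fun x _ => hasDeriv_re hg x y)
      ((cont_mk1 (dv_smooth hg _).continuous y).intervalIntegrable _ _)]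
    have := per_re hp 0 y
    rw [zero_add] at this; rw [this, sub_self]
  rw [ci_swap (dv_smooth hg _).continuous]
  simp [this]

lemma ci_lap {g : ℂ → ℝ} (hg : ContDiff ℝ ∞ g) (hp : PerC g) : cellInt (lapC g) = 0 := by
  have := ci_add (dv_smooth (dv_smooth hg 1) 1).continuous
    (dv_smooth (dv_smooth hg Complex.I) Complex.I).continuous
  rw [ci_dv1 (dv_smooth hg 1) (hp.dv 1), ci_dvI (dv_smooth hg _) (hp.dv _), add_zero] at this
  exact this

/-- inner product of gradients -/
def gdot (X Y : ℂ → ℝ) (z : ℂ) : ℝ := dv 1 X z * dv 1 Y z + dv Complex.I X z * dv Complex.I Y z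

lemma dv_mulR {f g : ℂ → ℝ} {z : ℂ} (hf : DifferentiableAt ℝ f z) (hg : DifferentiableAt ℝ g z)
    (v : ℂ) :
    dv v (fun z => f z * g z) z = dv v f z * g z + f z * dv v g z := by
  simp only [dv]
  rw [fderiv_fun_mul hf hg]
  simp; ring

lemma gdot_cont {X Y : ℂ → ℝ} (hX : ContDiff ℝ ∞ X) (hY : ContDiff ℝ ∞ Y) :
    Continuous (gdot X Y) :=
  ((dv_smooth hX 1).continuous.mul (dv_smooth hY 1).continuous).add
    ((dv_smooth hX _).continuous.mul (dv_smooth hY _).continuous)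

lemma ci_green {X Y : ℂ → ℝ} (hX : ContDiff ℝ ∞ X) (hY : ContDiff ℝ ∞ Y) (pX : PerC X)
    (pY : PerC Y) : cellInt (fun z => X z * lapC Y z + gdot X Y z) = 0 := by
  have s : ∀ v, ContDiff ℝ ∞ (fun z => X z * dv v Y z) := fun v => hX.mul (dv_smooth hY v)
  have p : ∀ v, PerC (fun z => X z * dv v Y z) := fun v z => by
    simp only [(pX z).1, (pX z).2, (pY.dv v z).1, (pY.dv v z).2, and_self]
  have e : (fun z => X z * lapC Y z + gdot X Y z) = fun z => dv 1 (fun z => X z * dv 1 Y z) z +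
      dv Complex.I (fun z => X z * dv Complex.I Y z) z := by
    funext z
    rw [dv_mulR (hX.differentiable (by simp) z) ((dv_smooth hY _).differentiable (by simp) z),
      dv_mulR (hX.differentiable (by simp) z) ((dv_smooth hY _).differentiable (by simp) z)]
    simp only [lapC, gdot]; ring
  rw [e, ci_add (dv_smooth (s 1) 1).continuous (dv_smooth (s _) _).continuous,
    ci_dv1 (s 1) (p 1), ci_dvI (s _) (p _), add_zero]

lemma ci_ball (R : ℝ) (hR : 0 < R) : ∃ N : ℝ, 0 ≤ N ∧ ∀ g : ℂ → ℝ, Continuous g → PerC g →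
    (∀ z, 0 ≤ g z) → ∀ y, ∫ z in ball y R, g z ≤ N * cellInt g := by
  obtain ⟨n, hn⟩ := exists_nat_gt (2 * R)
  refine ⟨n * n, by positivity, ?_⟩
  intro g hg hp h0 y
  set a := y.re - R
  set b := y.im - R
  set S : Set (ℝ × ℝ) := Icc a (a + n) ×ˢ Icc b (b + n) with hS
  have hcp : Continuous (fun p : ℝ × ℝ => g ⟨p.1, p.2⟩) := hg.comp cont_mk
  have hK : IsCompact S := isCompact_Icc.prod isCompact_Icc
  have hI : IntegrableOn (fun p : ℝ × ℝ => g ⟨p.1, p.2⟩) S := hcp.continuousOn.integrableOn_compact hK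
  have hn0 : (0:ℝ) ≤ n := by positivity
  have e1 : ∫ z in ball y R, g z =
      ∫ p in Complex.measurableEquivRealProd.symm ⁻¹' (ball y R), g ⟨p.1, p.2⟩ := by
    have := Complex.volume_preserving_equiv_real_prod.symm.setIntegral_preimage_emb
      Complex.measurableEquivRealProd.symm.measurableEmbedding g (ball y R)
    rw [← this]; rfl
  have hsub : Complex.measurableEquivRealProd.symm ⁻¹' (ball y R) ⊆ S := by
    intro p hpp
    simp only [mem_preimage, Complex.measurableEquivRealProd_symm_apply, mem_ball,
      dist_eq_norm] at hpp
    have h1 := (Complex.abs_re_le_norm _).trans_lt hpp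
    have h2 := (Complex.abs_im_le_norm _).trans_lt hpp
    simp only [Complex.sub_re, Complex.sub_im, abs_lt] at h1 h2
    simp only [hS, mem_prod, mem_Icc, a, b]
    refine ⟨⟨?_, ?_⟩, ?_, ?_⟩ <;> linarith [h1.1, h1.2, h2.1, h2.2]
  have e2 : ∫ p in S, g ⟨p.1, p.2⟩ = ∫ x in a..(a + n), ∫ y in b..(b + n), g ⟨x, y⟩ := by
    rw [intervalIntegral.integral_of_le (by linarith)]
    simp_rw [intervalIntegral.integral_of_le (show b ≤ b + (n:ℝ) by linarith)]
    rw [Measure.volume_eq_prod, setIntegral_prod _ hI, integral_Icc_eq_integral_Ioc]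
    simp_rw [integral_Icc_eq_integral_Ioc]
  have e3 : ∀ x : ℝ, ∫ y in b..(b + n), g ⟨x, y⟩ = n * ∫ y in (0:ℝ)..1, g ⟨x, y⟩ := by
    intro x
    have P : Function.Periodic (fun y : ℝ => g ⟨x, y⟩) 1 := fun y => per_im hp x y
    have := P.intervalIntegral_add_zsmul_eq n b (fun _ _ => (cont_mk2 hg x).intervalIntegrable _ _)
    rw [P.intervalIntegral_add_eq b 0] at this
    simpa using this
  have e4 : ∫ x in a..(a + n), ∫ y in (0:ℝ)..1, g ⟨x, y⟩ = n * cellInt g := by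
    have P : Function.Periodic (fun x : ℝ => ∫ y in (0:ℝ)..1, g ⟨x, y⟩) 1 := fun x => by
      simp only [per_re hp]
    have := P.intervalIntegral_add_zsmul_eq n a
      (fun _ _ => (cont_inner hg 0 1).intervalIntegrable _ _)
    rw [P.intervalIntegral_add_eq a 0] at this
    simpa [cellInt] using this
  rw [e1]
  refine (setIntegral_mono_set hI (Eventually.of_forall fun p => h0 _) hsub.eventuallyLE).trans ?_
  rw [e2]
  simp_rw [e3]
  rw [intervalIntegral.integral_const_mul, e4, mul_assoc]

/-- extension of a function across removable singularities -/
def ext0 (h : ℂ → ℝ) (z : ℂ) : ℝ := limUnder (𝓝[≠] z) h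

/-- all singularities are removable -/
def RemSm (h : ℂ → ℝ) : Prop := ∀ p, ∃ v : ℂ → ℝ, ContDiffAt ℝ ∞ v p ∧ ∀ᶠ z in 𝓝[≠] p, h z = v z

lemma ext0_eq_of {h v : ℂ → ℝ} {p : ℂ} (hv : ContDiffAt ℝ ∞ v p)
    (he : ∀ᶠ z in 𝓝[≠] p, h z = v z) : ext0 h =ᶠ[𝓝 p] v := by
  have key : ∀ z, ContinuousAt v z → (∀ᶠ y in 𝓝[≠] z, h y = v y) → ext0 h z = v z := by
    intro z hz hh
    have h1 : Tendsto v (𝓝[≠] z) (𝓝 (v z)) := hz.tendsto.mono_left nhdsWithin_le_nhds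
    exact (h1.congr' (hh.mono fun y hy => hy.symm)).limUnder_eq
  have hc : ∀ᶠ z in 𝓝 p, ContinuousAt v z := by
    have := (hv.of_le (m := 1) (by simp)).eventually (by simp)
    exact this.mono fun z hz => hz.continuousAt
  rw [eventually_nhdsWithin_iff] at he
  filter_upwards [hc, he.eventually_nhds] with z h1 h2
  by_cases hzp : z = p
  · subst hzp
    exact key z h1 (eventually_nhdsWithin_iff.2 h2)
  · apply key z h1
    apply eventually_nhdsWithin_of_eventually_nhds
    filter_upwards [h2, isOpen_ne.mem_nhds hzp] with y hy hyp
    exact hy hyp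

lemma ext0_smooth {h : ℂ → ℝ} (hh : RemSm h) : ContDiff ℝ ∞ (ext0 h) := by
  rw [contDiff_iff_contDiffAt]
  intro p
  obtain ⟨v, hv, he⟩ := hh p
  exact hv.congr_of_eventuallyEq (ext0_eq_of hv he)

lemma ext0_eq {h : ℂ → ℝ} {p : ℂ} (hh : ContDiffAt ℝ ∞ h p) : ext0 h =ᶠ[𝓝 p] h :=
  ext0_eq_of hh (Eventually.of_forall fun _ => rfl)

lemma ext0_per {h : ℂ → ℝ} (hh : RemSm h) (hp : PerC h) : PerC (ext0 h) := by
  have key : ∀ c : ℂ, (∀ z, h (z + c) = h z) → ∀ z, ext0 h (z + c) = ext0 h z := by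
    intro c hc z
    obtain ⟨v, hv, he⟩ := hh z
    have h1 := (ext0_eq_of hv he).eq_of_nhds
    have hs : ContDiffAt ℝ ∞ (fun y : ℂ => y - c) (z + c) := contDiffAt_id.sub contDiffAt_const
    have hv' : ContDiffAt ℝ ∞ (fun y => v (y - c)) (z + c) := by
      refine ContDiffAt.comp (z + c) (g := v) ?_ hs
      simpa using hv
    have he' : ∀ᶠ y in 𝓝[≠] (z + c), h y = v (y - c) := by
      have ht : Tendsto (fun y : ℂ => y - c) (𝓝[≠] (z + c)) (𝓝[≠] z) := by
        apply tendsto_nhdsWithin_of_tendsto_nhds_of_eventually_within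
        · have := hs.continuousAt.tendsto
          simp only [add_sub_cancel_right] at this
          exact this.mono_left nhdsWithin_le_nhds
        · filter_upwards [self_mem_nhdsWithin] with y hy
          intro hyz
          apply hy
          simp only [mem_singleton_iff] at hyz ⊢
          rw [← hyz]; ring
      filter_upwards [ht.eventually he] with y hy
      rw [← hy, ← hc (y - c), sub_add_cancel]
    rw [h1, (ext0_eq_of hv' he').eq_of_nhds]
    simp
  exact fun z => ⟨key 1 (fun z => (hp z).1) z, key Complex.I (fun z => (hp z).2) z⟩

lemma dv_congr_ev {f g : ℂ → ℝ} {z : ℂ} (h : f =ᶠ[𝓝 z] g) (v : ℂ) : dv v f =ᶠ[𝓝 z] dv v g := by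
  filter_upwards [h.fderiv (𝕜 := ℝ)] with y hy
  simp only [dv, hy]

lemma lapC_congr_ev {f g : ℂ → ℝ} {z : ℂ} (h : f =ᶠ[𝓝 z] g) : lapC f z = lapC g z := by
  simp only [lapC]
  rw [(dv_congr_ev (dv_congr_ev h 1) 1).eq_of_nhds,
    (dv_congr_ev (dv_congr_ev h Complex.I) Complex.I).eq_of_nhds]

lemma dv_smoothAt {f : ℂ → ℝ} {z : ℂ} (h : ContDiffAt ℝ ∞ f z) (v : ℂ) :
    ContDiffAt ℝ ∞ (dv v f) z :=
  (h.fderiv_right (m := ∞) (by simp)).clm_apply contDiffAt_const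

lemma smoothAt_ev {f : ℂ → ℝ} {z : ℂ} (h : ContDiffAt ℝ ∞ f z) :
    ∀ᶠ y in 𝓝 z, DifferentiableAt ℝ f y := by
  have := (h.of_le (m := 1) (by simp)).eventually (by simp)
  exact this.mono fun z hz => hz.differentiableAt (by simp)

lemma dv_chain {G : ℝ → ℝ} (hG : ContDiff ℝ ∞ G) {a : ℂ → ℝ} {z : ℂ}
    (ha : DifferentiableAt ℝ a z) (v : ℂ) :
    dv v (fun z => G (a z)) z = deriv G (a z) * dv v a z := by
  have h1 : HasDerivAt G (deriv G (a z)) (a z) := (hG.differentiable (by simp) _).hasDerivAt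
  have := h1.comp_hasFDerivAt z ha.hasFDerivAt
  have h2 : HasFDerivAt (fun z => G (a z)) _ z := this
  simp only [dv]; rw [h2.fderiv]; simp

lemma lapC_chain {G : ℝ → ℝ} (hG : ContDiff ℝ ∞ G) {a : ℂ → ℝ} {z : ℂ} (ha : ContDiffAt ℝ ∞ a z) :
    lapC (fun z => G (a z)) z = deriv G (a z) * lapC a z + deriv (deriv G) (a z) * gdot a a z := by
  have hG' : ContDiff ℝ ∞ (deriv G) := (contDiff_infty_iff_deriv.1 hG).2
  have hd := ha.differentiableAt (by simp)
  have key : ∀ v, dv v (dv v (fun z => G (a z))) z =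
      deriv G (a z) * dv v (dv v a) z + deriv (deriv G) (a z) * (dv v a z * dv v a z) := by
    intro v
    have e : dv v (fun z => G (a z)) =ᶠ[𝓝 z] fun z => deriv G (a z) * dv v a z := by
      filter_upwards [smoothAt_ev ha] with y hy
      exact dv_chain hG hy v
    rw [(dv_congr_ev e v).eq_of_nhds, dv_mulR, dv_chain hG' hd]
    · ring
    · exact (hG'.differentiable (by simp) _).comp z hd
    · exact (dv_smoothAt ha v).differentiableAt (by simp)
  simp only [lapC, key, gdot]; ring

lemma dv_sub {a b : ℂ → ℝ} {z : ℂ} (ha : DifferentiableAt ℝ a z) (hb : DifferentiableAt ℝ b z)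
    (v : ℂ) : dv v (fun z => a z - b z) z = dv v a z - dv v b z := by
  simp only [dv]; rw [fderiv_fun_sub ha hb]; simp

lemma lapC_sub {a b : ℂ → ℝ} {z : ℂ} (ha : ContDiffAt ℝ ∞ a z) (hb : ContDiffAt ℝ ∞ b z) :
    lapC (fun z => a z - b z) z = lapC a z - lapC b z := by
  have key : ∀ v, dv v (dv v (fun z => a z - b z)) z = dv v (dv v a) z - dv v (dv v b) z := by
    intro v
    have e : dv v (fun z => a z - b z) =ᶠ[𝓝 z] fun z => dv v a z - dv v b z := by
      filter_upwards [smoothAt_ev ha, smoothAt_ev hb] with y h1 h2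
      exact dv_sub h1 h2 v
    rw [(dv_congr_ev e v).eq_of_nhds, dv_sub ((dv_smoothAt ha v).differentiableAt (by simp))
      ((dv_smoothAt hb v).differentiableAt (by simp))]
  simp only [lapC, key]; ring

lemma gdot_congr_ev {f g f' g' : ℂ → ℝ} {z : ℂ} (h : f =ᶠ[𝓝 z] g) (h' : f' =ᶠ[𝓝 z] g') :
    gdot f f' z = gdot g g' z := by
  simp only [gdot, (dv_congr_ev h _).eq_of_nhds, (dv_congr_ev h' _).eq_of_nhds]

/-- functions constant near infinity -/
def CstInf (G : ℝ → ℝ) : Prop := ∃ K c₁ c₂ : ℝ, (∀ t, K ≤ t → G t = c₁) ∧ ∀ t, t ≤ -K → G t = c₂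

/-- logarithmic singularity structure -/
def LogS (s : ℂ → ℝ) (a : ℂ → ℝ) : Prop := ∀ p, ∃ v : ℂ → ℝ, ContDiffAt ℝ ∞ v p ∧
  ∀ᶠ z in 𝓝[≠] p, a z = 2 * s p * Real.log ‖z - p‖ + v z

lemma LogS.remSm_sub {s a b : ℂ → ℝ} (ha : LogS s a) (hb : LogS s b) :
    RemSm (fun z => a z - b z) := by
  intro p
  obtain ⟨v, hv, h1⟩ := ha p
  obtain ⟨v', hv', h2⟩ := hb p
  refine ⟨fun z => v z - v' z, hv.sub hv', ?_⟩
  filter_upwards [h1, h2] with z e1 e2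
  rw [e1, e2]; ring

lemma log_tendsto (p : ℂ) : Tendsto (fun z => Real.log ‖z - p‖) (𝓝[≠] p) atBot := by
  refine Real.tendsto_log_nhdsGT_zero.comp ?_
  exact tendsto_norm_sub_self_nhdsNE p

lemma LogS.remSm_comp {s a : ℂ → ℝ} (ha : LogS s a) {G : ℝ → ℝ} (hG : ContDiff ℝ ∞ G)
    (hc : CstInf G) : RemSm (fun z => G (a z)) := by
  intro p
  obtain ⟨v, hv, h1⟩ := ha p
  obtain ⟨K, c₁, c₂, k1, k2⟩ := hc
  have hvt : Tendsto v (𝓝[≠] p) (𝓝 (v p)) := hv.continuousAt.tendsto.mono_left nhdsWithin_le_nhds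
  rcases lt_trichotomy (s p) 0 with h | h | h
  · refine ⟨fun _ => c₁, contDiffAt_const, ?_⟩
    have : Tendsto a (𝓝[≠] p) atTop := by
      refine Tendsto.congr' (h1.mono fun z hz => hz.symm) ?_
      exact (((log_tendsto p).const_mul_atBot_of_neg (by linarith)).atTop_add hvt)
    filter_upwards [this.eventually_ge_atTop K] with z hz using k1 _ hz
  · refine ⟨fun z => G (v z), hG.contDiffAt.comp p hv, ?_⟩
    filter_upwards [h1] with z hz
    rw [hz, h]; simp
  · refine ⟨fun _ => c₂, contDiffAt_const, ?_⟩
    have : Tendsto a (𝓝[≠] p) atBot := by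
      refine Tendsto.congr' (h1.mono fun z hz => hz.symm) ?_
      exact (((log_tendsto p).const_mul_atBot (by linarith)).atBot_add hvt)
    filter_upwards [this.eventually_le_atBot (-K)] with z hz using k2 _ hz

/-- smooth step -/
def st (x : ℝ) : ℝ := Real.smoothTransition x

lemma st_smooth : ContDiff ℝ ∞ st := Real.smoothTransition.contDiff

lemma st_deriv (x : ℝ) : HasDerivAt st (deriv st x) x :=
  (st_smooth.differentiable (by simp) x).hasDerivAt

lemma st_deriv_nonneg (x : ℝ) : 0 ≤ deriv st x :=
  Real.smoothTransition.monotone.deriv_nonneg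

lemma st_one {x : ℝ} (h : 1 ≤ x) : st x = 1 := Real.smoothTransition.one_of_one_le h
lemma st_zero {x : ℝ} (h : x ≤ 0) : st x = 0 := Real.smoothTransition.zero_of_nonpos h
lemma st_nonneg (x : ℝ) : 0 ≤ st x := Real.smoothTransition.nonneg x
lemma st_le_one (x : ℝ) : st x ≤ 1 := Real.smoothTransition.le_one x

lemma st_deriv_one {x : ℝ} (h : 1 ≤ x) : deriv st x = 0 := by
  apply IsLocalMax.deriv_eq_zero
  refine Eventually.of_forall fun y => ?_
  rw [st_one h]; exact st_le_one y

lemma st_deriv_zero {x : ℝ} (h : x ≤ 0) : deriv st x = 0 := by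
  apply IsLocalMin.deriv_eq_zero
  refine Eventually.of_forall fun y => ?_
  rw [st_zero h]; exact st_nonneg y

/-- smooth sign at scale `δ` -/
def psi (δ t : ℝ) : ℝ := st (t / δ) - st (-t / δ)

lemma psi_smooth (δ : ℝ) : ContDiff ℝ ∞ (psi δ) :=
  (st_smooth.comp (contDiff_id.div_const δ)).sub (st_smooth.comp (contDiff_neg.div_const δ))

lemma psi_deriv (δ t : ℝ) : deriv (psi δ) t = (deriv st (t / δ) + deriv st (-t / δ)) / δ := by
  have h1 : HasDerivAt (fun t : ℝ => st (t / δ)) (deriv st (t / δ) * (1 / δ)) t :=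
    (st_deriv (t / δ)).comp t ((hasDerivAt_id t).div_const δ)
  have h2 : HasDerivAt (fun t : ℝ => st (-t / δ)) (deriv st (-t / δ) * (-1 / δ)) t :=
    (st_deriv (-t / δ)).comp t ((hasDerivAt_neg t).div_const δ)
  have h3 : HasDerivAt (psi δ) _ t := h1.sub h2
  rw [h3.deriv]; ring

lemma psi_deriv_nonneg {δ : ℝ} (hδ : 0 < δ) (t : ℝ) : 0 ≤ deriv (psi δ) t := by
  rw [psi_deriv]
  have := st_deriv_nonneg (t / δ)
  have := st_deriv_nonneg (-t / δ)
  positivity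

lemma psi_pos {δ t : ℝ} (hδ : 0 < δ) (h : δ ≤ t) : psi δ t = 1 := by
  have h1 : 1 ≤ t / δ := by rwa [one_le_div hδ]
  have h2 : -t / δ ≤ 0 := by rw [neg_div]; linarith
  rw [psi, st_one h1, st_zero h2, sub_zero]

lemma psi_neg {δ t : ℝ} (hδ : 0 < δ) (h : t ≤ -δ) : psi δ t = -1 := by
  have h1 : 1 ≤ -t / δ := by rw [one_le_div hδ]; linarith
  have h2 : t / δ ≤ 0 := by rw [neg_div] at h1; linarith
  rw [psi, st_one h1, st_zero h2, zero_sub]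

lemma psi_abs (δ t : ℝ) : |psi δ t| ≤ 1 := by
  rw [psi, abs_le]
  constructor <;> linarith [st_nonneg (t / δ), st_le_one (t / δ), st_nonneg (-t / δ), st_le_one (-t / δ)]

lemma psi_sign_pos {δ t : ℝ} (hδ : 0 < δ) (h : 0 ≤ t) : 0 ≤ psi δ t := by
  have h2 : -t / δ ≤ 0 := by
    rw [neg_div]; have : 0 ≤ t / δ := by positivity
    linarith
  rw [psi, st_zero h2, sub_zero]; exact st_nonneg _

lemma psi_sign_neg {δ t : ℝ} (hδ : 0 < δ) (h : t ≤ 0) : psi δ t ≤ 0 := by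
  have h2 : t / δ ≤ 0 := div_nonpos_of_nonpos_of_nonneg h hδ.le
  rw [psi, st_zero h2, zero_sub]; linarith [st_nonneg (-t / δ)]

lemma psi_deriv_out {δ t : ℝ} (hδ : 0 < δ) (h : δ < |t|) : deriv (psi δ) t = 0 := by
  rw [psi_deriv]
  rcases le_abs.1 h.le with h | h
  · have h1 : 1 ≤ t / δ := by rwa [one_le_div hδ]
    have h2 : -t / δ ≤ 0 := by rw [neg_div]; linarith
    rw [st_deriv_one h1, st_deriv_zero h2]; simp
  · have h1 : 1 ≤ -t / δ := by rwa [one_le_div hδ]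
    have h2 : t / δ ≤ 0 := by rw [neg_div] at h1; linarith
    rw [st_deriv_one h1, st_deriv_zero h2]; simp

lemma psi_cst {δ : ℝ} (hδ : 0 < δ) : CstInf (psi δ) :=
  ⟨δ, 1, -1, fun _ h => psi_pos hδ h, fun _ h => psi_neg hδ h⟩

/-- smooth cutoff at level `k` -/
def kap (k t : ℝ) : ℝ := st (k + 1 - t) * st (k + 1 + t)

lemma kap_smooth (k : ℝ) : ContDiff ℝ ∞ (kap k) :=
  (st_smooth.comp (contDiff_const.sub contDiff_id)).mul
    (st_smooth.comp (contDiff_const.add contDiff_id))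

lemma kap_deriv (k t : ℝ) : deriv (kap k) t =
    -deriv st (k + 1 - t) * st (k + 1 + t) + st (k + 1 - t) * deriv st (k + 1 + t) := by
  have h1 : HasDerivAt (fun t : ℝ => st (k + 1 - t)) (deriv st (k + 1 - t) * (-1)) t :=
    (st_deriv (k + 1 - t)).comp t ((hasDerivAt_id t).const_sub (k + 1))
  have h2 : HasDerivAt (fun t : ℝ => st (k + 1 + t)) (deriv st (k + 1 + t) * 1) t :=
    (st_deriv (k + 1 + t)).comp t ((hasDerivAt_id t).const_add (k + 1))
  have h3 : HasDerivAt (kap k) _ t := h1.mul h2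
  rw [h3.deriv]; ring

lemma kap_nonneg (k t : ℝ) : 0 ≤ kap k t := mul_nonneg (st_nonneg _) (st_nonneg _)
lemma kap_le_one (k t : ℝ) : kap k t ≤ 1 := mul_le_one₀ (st_le_one _) (st_nonneg _) (st_le_one _)
lemma kap_in {k t : ℝ} (h : |t| ≤ k) : kap k t = 1 := by
  rw [abs_le] at h
  rw [kap, st_one (by linarith), st_one (by linarith), one_mul]
lemma kap_out {k t : ℝ} (h : k + 1 ≤ |t|) : kap k t = 0 := by
  rcases le_abs.1 h with h | h
  · rw [kap, st_zero (by linarith), zero_mul]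
  · rw [kap, st_zero (x := k + 1 + t) (by linarith), mul_zero]

lemma kap_ineq {k : ℝ} (hk : 1 ≤ k) (t : ℝ) :
    |deriv (kap k) t| + (deriv (psi 1) t * kap k t + psi 1 t * deriv (kap k) t) ≤
      deriv (psi 1) t := by
  have h1 : |deriv (kap k) t| + psi 1 t * deriv (kap k) t = 0 := by
    rw [kap_deriv]
    by_cases c1 : k ≤ t
    · rw [psi_pos one_pos (hk.trans c1), st_deriv_one (x := k + 1 + t) (by linarith),
        st_one (x := k + 1 + t) (by linarith), mul_zero, add_zero, abs_of_nonpos]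
      · ring
      · linarith [st_deriv_nonneg (k + 1 - t)]
    · by_cases c2 : t ≤ -k
      · rw [psi_neg one_pos (by linarith), st_deriv_one (x := k + 1 - t) (by linarith),
          st_one (x := k + 1 - t) (by linarith), neg_zero, zero_mul, zero_add, abs_of_nonneg]
        · ring
        · linarith [st_deriv_nonneg (k + 1 + t)]
      · push Not at c1 c2
        rw [st_deriv_one (x := k + 1 - t) (by linarith), st_deriv_one (x := k + 1 + t) (by linarith)]
        simp
  have h2 : deriv (psi 1) t * kap k t ≤ deriv (psi 1) t :=
    mul_le_of_le_one_right (psi_deriv_nonneg one_pos t) (kap_le_one k t)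
  linarith

/-- primitive -/
def prim (g : ℝ → ℝ) (t : ℝ) : ℝ := ∫ x in (0:ℝ)..t, g x

lemma prim_deriv {g : ℝ → ℝ} (hg : ContDiff ℝ ∞ g) : deriv (prim g) = g := by
  funext t
  exact (hg.continuous.integral_hasStrictDerivAt 0 t).hasDerivAt.deriv

lemma prim_smooth {g : ℝ → ℝ} (hg : ContDiff ℝ ∞ g) : ContDiff ℝ ∞ (prim g) := by
  rw [contDiff_infty_iff_deriv, prim_deriv hg]
  exact ⟨fun t => (hg.continuous.integral_hasStrictDerivAt 0 t).hasDerivAt.differentiableAt, hg⟩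

lemma prim_cst {g : ℝ → ℝ} (hg : ContDiff ℝ ∞ g) {K : ℝ}
    (h : ∀ t, K ≤ |t| → g t = 0) : CstInf (prim g) := by
  have hi : ∀ a b, IntervalIntegrable g volume a b := fun a b => hg.continuous.intervalIntegrable a b
  refine ⟨K, prim g K, prim g (-K), fun t ht => ?_, fun t ht => ?_⟩
  · rw [prim, ← intervalIntegral.integral_add_adjacent_intervals (hi 0 K) (hi K t)]
    rw [intervalIntegral.integral_congr (g := fun _ => 0) (a := K)]
    · simp [prim]
    · intro x hx
      rw [uIcc_of_le ht] at hx
      exact h x (hx.1.trans (le_abs_self x))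
  · rw [prim, ← intervalIntegral.integral_add_adjacent_intervals (hi 0 (-K)) (hi (-K) t)]
    rw [intervalIntegral.integral_congr (g := fun _ => 0) (a := -K)]
    · simp [prim]
    · intro x hx
      rw [uIcc_of_ge ht] at hx
      exact h x (le_trans (by linarith [hx.2]) (neg_le_abs x))

/-- local copy of the nonlinearity -/
def ff (τ t : ℝ) : ℝ := exp t * (1 - exp t) / (τ + exp t) ^ 3

/-- constant -/
def cA (τ : ℝ) : ℝ := (1 / τ ^ 2 + 1 / τ) + 2 / τ ^ 2

lemma cA_pos {τ : ℝ} (hτ : 0 < τ) : 0 < cA τ := by unfold cA; positivity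

lemma ff_abs1 {τ : ℝ} (hτ : 0 < τ) (t : ℝ) : |ff τ t| ≤ 1 / τ ^ 2 + 1 / τ := by
  have hs := exp_pos t
  rw [ff]; generalize exp t = s at *
  rw [abs_div, abs_mul, abs_of_pos hs, abs_of_pos (by positivity : 0 < (τ + s) ^ 3)]
  have h1 : |1 - s| ≤ 1 + s := by rw [abs_le]; constructor <;> linarith
  rw [div_le_iff₀ (by positivity)]
  refine (mul_le_mul_of_nonneg_left h1 hs.le).trans ?_
  have e : (1 / τ ^ 2 + 1 / τ) * (τ + s) ^ 3 - s * (1 + s) =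
    (s * (2 + 3 * s / τ + s ^ 2 / τ ^ 2) + τ) + (τ ^ 2 + 3 * s * τ + 2 * s ^ 2 + s ^ 3 / τ)  := by
    field_simp; ring
  have : 0 ≤ (1 / τ ^ 2 + 1 / τ) * (τ + s) ^ 3 - s * (1 + s) := by rw [e]; positivity
  linarith

lemma ff_abs2 {τ : ℝ} (hτ : 0 < τ) {t : ℝ} (ht : |t| ≤ 1) : |ff τ t| ≤ 2 / τ ^ 2 * |t| := by
  have hs := exp_pos t
  have h1 := Real.abs_exp_sub_one_le ht
  rw [ff]; generalize exp t = s at *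
  rw [abs_div, abs_mul, abs_of_pos hs, abs_of_pos (by positivity : 0 < (τ + s) ^ 3), abs_sub_comm,
    div_le_iff₀ (by positivity)]
  have h2 : s ≤ 1 / τ ^ 2 * (τ + s) ^ 3 := by
    have e : 1 / τ ^ 2 * (τ + s) ^ 3 - s = τ + 2 * s + 3 * s ^ 2 / τ + s ^ 3 / τ ^ 2 := by
      field_simp; ring
    have : 0 ≤ 1 / τ ^ 2 * (τ + s) ^ 3 - s := by rw [e]; positivity
    linarith
  calc s * |s - 1| ≤ (1 / τ ^ 2 * (τ + s) ^ 3) * (2 * |t|) := by gcongr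
    _ = _ := by ring

lemma ff_le {τ : ℝ} (hτ : 0 < τ) (t : ℝ) : |ff τ t| ≤ cA τ := by
  have := ff_abs1 hτ t
  have : 0 ≤ 2 / τ ^ 2 := by positivity
  unfold cA; linarith

lemma ff_lin {τ : ℝ} (hτ : 0 < τ) (t : ℝ) : |ff τ t| ≤ cA τ * |t| := by
  by_cases h : |t| ≤ 1
  · refine (ff_abs2 hτ h).trans ?_
    gcongr
    unfold cA
    have : 0 ≤ 1 / τ ^ 2 + 1 / τ := by positivity
    linarith
  · push Not at h
    exact (ff_le hτ t).trans (le_mul_of_one_le_right (cA_pos hτ).le h.le)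

lemma ff_nonpos {τ : ℝ} (hτ : 0 < τ) {t : ℝ} (h : 0 ≤ t) : ff τ t ≤ 0 := by
  have := one_le_exp h
  apply div_nonpos_of_nonpos_of_nonneg
  · exact mul_nonpos_of_nonneg_of_nonpos (exp_pos t).le (by linarith)
  · have := exp_pos t; positivity

lemma ff_nonneg {τ : ℝ} (hτ : 0 < τ) {t : ℝ} (h : t ≤ 0) : 0 ≤ ff τ t := by
  have := exp_le_one_iff.2 h
  apply div_nonneg
  · exact mul_nonneg (exp_pos t).le (by linarith)
  · have := exp_pos t; positivity

lemma ff_psi {τ δ : ℝ} (hτ : 0 < τ) (hδ : 0 < δ) (t : ℝ) :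
    |ff τ t| ≤ -(ff τ t * psi δ t) + cA τ * δ := by
  have hc := cA_pos hτ
  have hcd : 0 < cA τ * δ := by positivity
  by_cases h1 : δ ≤ t
  · rw [psi_pos hδ h1, abs_of_nonpos (ff_nonpos hτ (by linarith))]; linarith
  · by_cases h2 : t ≤ -δ
    · rw [psi_neg hδ h2, abs_of_nonneg (ff_nonneg hτ (by linarith))]; linarith
    · push Not at h1 h2
      have h3 : |ff τ t| ≤ cA τ * δ :=
        (ff_lin hτ t).trans (by gcongr; exact abs_le.2 ⟨h2.le, h1.le⟩)
      have h4 : ff τ t * psi δ t ≤ 0 := by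
        rcases le_total 0 t with h | h
        · exact mul_nonpos_of_nonpos_of_nonneg (ff_nonpos hτ h) (psi_sign_pos hδ h)
        · exact mul_nonpos_of_nonneg_of_nonpos (ff_nonneg hτ h) (psi_sign_neg hδ h)
      linarith

/-- solutions transported to `ℂ` -/
structure SolC (Z : Set ℂ) (s : ℂ → ℝ) (τ ε : ℝ) (a : ℂ → ℝ) : Prop where
  per : PerC a
  smooth : ∀ z ∉ Z, ContDiffAt ℝ ∞ a z
  pde : ∀ z ∉ Z, lapC a z = -((ε ^ 2)⁻¹ * ff τ (a z))
  sing : LogS s a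

lemma le_of_dense {Z : Set ℂ} (hZ : Z.Countable) {f g : ℂ → ℝ} (hf : Continuous f)
    (hg : Continuous g) (h : ∀ z ∉ Z, f z ≤ g z) (z : ℂ) : f z ≤ g z := by
  have hd : Dense Zᶜ := hZ.dense_compl ℝ
  have hc : IsClosed {z | f z ≤ g z} := isClosed_le hf hg
  have : closure Zᶜ ⊆ {z | f z ≤ g z} := hc.closure_subset_iff.2 (fun z hz => h z hz)
  rw [hd.closure_eq] at this
  exact this (mem_univ z)

lemma PerC.comp {a : ℂ → ℝ} (h : PerC a) (G : ℝ → ℝ) : PerC (fun z => G (a z)) := fun z => by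
  simp only [(h z).1, (h z).2, and_self]

lemma PerC.sub {a b : ℂ → ℝ} (h : PerC a) (h' : PerC b) : PerC (fun z => a z - b z) := fun z => by
  simp only [(h z).1, (h z).2, (h' z).1, (h' z).2, and_self]

lemma PerC.gdot {a b : ℂ → ℝ} (h : PerC a) (h' : PerC b) : PerC (gdot a b) := fun z => by
  simp only [_root_.gdot, (h.dv _ z).1, (h.dv _ z).2, (h'.dv _ z).1, (h'.dv _ z).2, and_self]

lemma gdot_self_nonneg (a : ℂ → ℝ) (z : ℂ) : 0 ≤ gdot a a z := by
  simp only [gdot]; nlinarith [sq_nonneg (dv 1 a z), sq_nonneg (dv Complex.I a z)]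

/-- truncation and its companion -/
def TT (k : ℝ) : ℝ → ℝ := prim (kap k)
/-- companion of the truncation -/
def RR (k : ℝ) : ℝ → ℝ := prim (fun t => psi 1 t * kap k t)

lemma TT_smooth (k : ℝ) : ContDiff ℝ ∞ (TT k) := prim_smooth (kap_smooth k)
lemma RR_smooth (k : ℝ) : ContDiff ℝ ∞ (RR k) := prim_smooth ((psi_smooth 1).mul (kap_smooth k))
lemma TT_deriv (k : ℝ) : deriv (TT k) = kap k := prim_deriv (kap_smooth k)
lemma RR_deriv (k : ℝ) : deriv (RR k) = fun t => psi 1 t * kap k t :=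
  prim_deriv ((psi_smooth 1).mul (kap_smooth k))
lemma TT_cst (k : ℝ) : CstInf (TT k) := prim_cst (kap_smooth k) (K := k + 1) fun _ h => kap_out h
lemma RR_cst (k : ℝ) : CstInf (RR k) :=
  prim_cst ((psi_smooth 1).mul (kap_smooth k)) (K := k + 1) fun _ h => by rw [kap_out h, mul_zero]

lemma RR_deriv2 (k t : ℝ) : deriv (fun t => psi 1 t * kap k t) t =
    deriv (psi 1) t * kap k t + psi 1 t * deriv (kap k) t :=
  deriv_fun_mul ((psi_smooth 1).differentiable (by simp) t) ((kap_smooth k).differentiable (by simp) t)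

lemma gdot_chain {G H : ℝ → ℝ} (hG : ContDiff ℝ ∞ G) (hH : ContDiff ℝ ∞ H) {a b : ℂ → ℝ} {z : ℂ}
    (ha : DifferentiableAt ℝ a z) (hb : DifferentiableAt ℝ b z) :
    gdot (fun z => G (a z)) (fun z => H (b z)) z = deriv G (a z) * deriv H (b z) * gdot a b z := by
  simp only [gdot, dv_chain hG ha, dv_chain hH hb]; ring

lemma L1bound {Z : Set ℂ} (hZ : Z.Countable) {s : ℂ → ℝ} {τ ε0 : ℝ} (hτ : 0 < τ)
    {b : ℂ → ℝ} (hb : SolC Z s τ ε0 b) :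
    ∃ C, 0 ≤ C ∧ ∀ ε > 0, ∀ a, SolC Z s τ ε a →
      cellInt (fun z => |lapC (ext0 (fun z => a z - b z)) z|) ≤ C := by
  set A := cA τ with hA
  have hA0 : 0 < A := cA_pos hτ
  set C0 := (ε0 ^ 2)⁻¹ * A with hC0
  have hC00 : 0 ≤ C0 := by positivity
  have hfb : ∀ z ∉ Z, |lapC b z| ≤ C0 := by
    intro z hz
    rw [hb.pde z hz, abs_neg, abs_mul, abs_of_nonneg (by positivity : 0 ≤ (ε0 ^ 2)⁻¹)]
    exact mul_le_mul_of_nonneg_left (ff_le hτ _) (by positivity)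
  -- the constant C2
  have rP1 := hb.sing.remSm_comp (psi_smooth 1) (psi_cst one_pos)
  have rT1 := hb.sing.remSm_comp (TT_smooth 1) (TT_cst 1)
  have cont1 := gdot_cont (ext0_smooth rP1) (ext0_smooth rT1)
  obtain ⟨z2, hz2⟩ := (PerC.gdot (ext0_per rP1 (hb.per.comp _))
    (ext0_per rT1 (hb.per.comp _))).exists_max cont1
  set C2 := gdot (ext0 fun z => psi 1 (b z)) (ext0 fun z => TT 1 (b z)) z2 with hC2
  have hC2b : ∀ z ∉ Z, deriv (psi 1) (b z) * gdot b b z ≤ C2 := by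
    intro z hz
    have sb := hb.smooth z hz
    have db := sb.differentiableAt (by simp)
    refine le_trans (le_of_eq ?_) (hz2 z)
    have q1 : ext0 (fun z => psi 1 (b z)) =ᶠ[𝓝 z] fun z => psi 1 (b z) :=
      ext0_eq ((psi_smooth 1).contDiffAt.comp z sb)
    have q2 : ext0 (fun z => TT 1 (b z)) =ᶠ[𝓝 z] fun z => TT 1 (b z) :=
      ext0_eq ((TT_smooth 1).contDiffAt.comp z sb)
    rw [gdot_congr_ev q1 q2, gdot_chain (psi_smooth 1) (TT_smooth 1) db db,
      TT_deriv]
    by_cases h : 1 < |b z|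
    · rw [psi_deriv_out one_pos h]; simp
    · rw [kap_in (not_lt.1 h), mul_one]
  refine ⟨max 0 (A + 4 * C0 + C2), le_max_left _ _, ?_⟩
  intro ε hε a ha
  refine le_trans ?_ (le_max_right _ _)
  have hδ : 0 < ε ^ 2 := by positivity
  have rw_ := ha.sing.remSm_sub hb.sing
  have rζ := ha.sing.remSm_comp (psi_smooth (ε ^ 2)) (psi_cst hδ)
  set w := ext0 (fun z => a z - b z) with hw
  set ζ := ext0 (fun z => psi (ε ^ 2) (a z)) with hζ
  have sw : ContDiff ℝ ∞ w := ext0_smooth rw_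
  have sζ : ContDiff ℝ ∞ ζ := ext0_smooth rζ
  have pw : PerC w := ext0_per rw_ (ha.per.sub hb.per)
  have pζ : PerC ζ := ext0_per rζ (ha.per.comp _)
  obtain ⟨zw, hzw⟩ := (pw.comp (fun t => |t|)).exists_max sw.continuous.abs
  set k := max 1 (ε ^ 2 + |w zw|) with hk
  have hk1 : 1 ≤ k := le_max_left _ _
  have rT := hb.sing.remSm_comp (TT_smooth k) (TT_cst k)
  have rR := hb.sing.remSm_comp (RR_smooth k) (RR_cst k)
  set T := ext0 (fun z => TT k (b z)) with hT
  set R := ext0 (fun z => RR k (b z)) with hR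
  have sT : ContDiff ℝ ∞ T := ext0_smooth rT
  have sR : ContDiff ℝ ∞ R := ext0_smooth rR
  have pT : PerC T := ext0_per rT (hb.per.comp _)
  have pR : PerC R := ext0_per rR (hb.per.comp _)
  have cw1 : Continuous (fun z => ζ z * lapC w z + gdot ζ w z) :=
    (sζ.continuous.mul (lapC_smooth sw).continuous).add (gdot_cont sζ sw)
  have cT1 : Continuous (fun z => ζ z * lapC T z + gdot ζ T z) :=
    (sζ.continuous.mul (lapC_smooth sT).continuous).add (gdot_cont sζ sT)
  have cR1 : Continuous (fun z => - lapC R z) := (lapC_smooth sR).continuous.neg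
  have cTR : Continuous (fun z => (ζ z * lapC T z + gdot ζ T z) + (- lapC R z)) := cT1.add cR1
  have cwTR : Continuous (fun z => (ζ z * lapC w z + gdot ζ w z) +
      ((ζ z * lapC T z + gdot ζ T z) + (- lapC R z))) := cw1.add cTR
  have call : Continuous (fun z => (A + 4 * C0 + C2) + ((ζ z * lapC w z + gdot ζ w z) +
      ((ζ z * lapC T z + gdot ζ T z) + (- lapC R z)))) := continuous_const.add cwTR
  have key : ∀ z, |lapC w z| ≤ (A + 4 * C0 + C2) + ((ζ z * lapC w z + gdot ζ w z) +
      ((ζ z * lapC T z + gdot ζ T z) + (- lapC R z))) := by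
    apply le_of_dense hZ (lapC_smooth sw).continuous.abs call
    intro z hz
    have sa := ha.smooth z hz
    have sb := hb.smooth z hz
    have da := sa.differentiableAt (by simp)
    have db := sb.differentiableAt (by simp)
    have ew : w =ᶠ[𝓝 z] fun z => a z - b z := ext0_eq (sa.sub sb)
    have eζ : ζ =ᶠ[𝓝 z] fun z => psi (ε ^ 2) (a z) :=
      ext0_eq ((psi_smooth _).contDiffAt.comp z sa)
    have eT : T =ᶠ[𝓝 z] fun z => TT k (b z) := ext0_eq ((TT_smooth _).contDiffAt.comp z sb)
    have eR : R =ᶠ[𝓝 z] fun z => RR k (b z) := ext0_eq ((RR_smooth _).contDiffAt.comp z sb)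
    have lw : lapC w z = lapC a z - lapC b z := by rw [lapC_congr_ev ew, lapC_sub sa sb]
    have lT : lapC T z = kap k (b z) * lapC b z + deriv (kap k) (b z) * gdot b b z := by
      rw [lapC_congr_ev eT, lapC_chain (TT_smooth k) sb, TT_deriv]
    have lR : lapC R z = psi 1 (b z) * kap k (b z) * lapC b z +
        (deriv (psi 1) (b z) * kap k (b z) + psi 1 (b z) * deriv (kap k) (b z)) * gdot b b z := by
      rw [lapC_congr_ev eR, lapC_chain (RR_smooth k) sb, RR_deriv, RR_deriv2]
    have vζ : ζ z = psi (ε ^ 2) (a z) := eζ.eq_of_nhds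
    have vw : w z = a z - b z := ew.eq_of_nhds
    have gw : gdot ζ w z = deriv (psi (ε ^ 2)) (a z) * (gdot a a z - gdot a b z) := by
      rw [gdot_congr_ev eζ ew]
      simp only [gdot, dv_chain (psi_smooth _) da, dv_sub da db]; ring
    have gT : gdot ζ T z = deriv (psi (ε ^ 2)) (a z) * gdot a b z := by
      rw [gdot_congr_ev eζ eT, gdot_chain (psi_smooth _) (TT_smooth k) da db, TT_deriv]
      by_cases h : ε ^ 2 < |a z|
      · rw [psi_deriv_out hδ h]; simp
      · rw [kap_in, mul_one]
        have h1 := hzw z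
        simp only [vw] at h1
        have h2 : |b z| ≤ |a z| + |a z - b z| := by
          have := abs_sub (a z) (a z - b z)
          simpa using this
        exact le_trans (by linarith [not_lt.1 h]) (le_max_right _ _)
    have hsum : 0 ≤ gdot ζ w z + gdot ζ T z := by
      rw [gw, gT]
      have := mul_nonneg (psi_deriv_nonneg hδ (a z)) (gdot_self_nonneg a z)
      linarith
    have hψ : |ζ z| ≤ 1 := by rw [vζ]; exact psi_abs _ _
    have s1 : |lapC w z| ≤ A + 2 * C0 + ζ z * lapC w z := by
      have f1 := ff_psi hτ hδ (a z)
      have f2 : |lapC a z| ≤ ζ z * lapC a z + A := by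
        rw [ha.pde z hz, abs_neg, abs_mul, abs_of_pos (inv_pos.2 hδ), vζ]
        calc (ε ^ 2)⁻¹ * |ff τ (a z)| ≤ (ε ^ 2)⁻¹ * (-(ff τ (a z) * psi (ε ^ 2) (a z)) + A * ε ^ 2) := by
              gcongr
          _ = _ := by field_simp
      have f3 : |ζ z * lapC b z| ≤ C0 := by
        rw [abs_mul]
        calc _ ≤ 1 * C0 := by gcongr; exact hfb z hz
          _ = _ := one_mul _
      rw [lw]
      have f4 := abs_sub (lapC a z) (lapC b z)
      have f5 := hfb z hz
      have f6 := (abs_le.1 f3).2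
      linarith
    have s2 : |lapC T z| ≤ 2 * C0 + C2 - lapC R z := by
      have g0 := gdot_self_nonneg b z
      have k1 := mul_le_mul_of_nonneg_right (kap_ineq hk1 (b z)) g0
      have k2 : |lapC T z| ≤ C0 + |deriv (kap k) (b z)| * gdot b b z := by
        rw [lT]
        refine (abs_add_le _ _).trans ?_
        rw [abs_mul, abs_mul, abs_of_nonneg g0, abs_of_nonneg (kap_nonneg _ _)]
        gcongr
        calc _ ≤ 1 * C0 := by gcongr; exacts [kap_le_one _ _, hfb z hz]
          _ = _ := one_mul _
      have k3 : |psi 1 (b z) * kap k (b z) * lapC b z| ≤ C0 := by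
        rw [abs_mul, abs_mul, abs_of_nonneg (kap_nonneg _ _)]
        calc _ ≤ 1 * 1 * C0 := by
              gcongr; exacts [kap_nonneg _ _, psi_abs _ _, kap_le_one _ _, hfb z hz]
          _ = _ := by ring
      have k4 := hC2b z hz
      have k5 := (abs_le.1 k3).2
      rw [lR]
      linarith
    have s3 : - (ζ z * lapC T z) ≤ |lapC T z| := by
      refine (neg_le_abs _).trans ?_
      rw [abs_mul]
      exact mul_le_of_le_one_left (abs_nonneg _) hψ
    linarith
  refine (ci_mono (lapC_smooth sw).continuous.abs call key).trans (le_of_eq ?_)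
  rw [ci_add continuous_const cwTR, ci_add cw1 cTR, ci_add cT1 cR1,
    ci_const, ci_green sζ sw pζ pw, ci_green sζ sT pζ pT, ci_neg, ci_lap sR pR]
  simp

lemma gradw_bound {Z : Set ℂ} (hZ : Z.Countable) {s : ℂ → ℝ} {τ ε0 : ℝ} (hτ : 0 < τ)
    {b : ℂ → ℝ} (hb : SolC Z s τ ε0 b) (E : ℝ) :
    ∃ C, 0 ≤ C ∧ ∀ ε > 0, ε ≤ E → ∀ a, SolC Z s τ ε a →
      ∀ z, ε * ‖gradC (ext0 (fun z => a z - b z)) z‖ ≤ C := by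
  obtain ⟨C, hC, L, hL, H⟩ := grad_bound
  obtain ⟨M, hM, hM1⟩ := L1bound hZ hτ hb
  obtain ⟨N, hN, hN1⟩ := ci_ball (2 * L) (by positivity)
  have hA := cA_pos hτ
  set C0 := (ε0 ^ 2)⁻¹ * cA τ with hC0
  have hC00 : 0 ≤ C0 := by positivity
  refine ⟨C * (cA τ + E ^ 2 * C0 + N * M), by positivity, ?_⟩
  intro ε hε hεE a ha z
  have sw : ContDiff ℝ ∞ (ext0 (fun z => a z - b z)) := ext0_smooth (ha.sing.remSm_sub hb.sing)
  have pw : PerC (ext0 (fun z => a z - b z)) :=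
    ext0_per (ha.sing.remSm_sub hb.sing) (ha.per.sub hb.per)
  have hM2 := hM1 ε hε a ha
  set w := ext0 (fun z => a z - b z) with hw
  have hlap : ∀ z, |lapC w z| ≤ (ε ^ 2)⁻¹ * cA τ + C0 := by
    apply le_of_dense hZ (lapC_smooth sw).continuous.abs continuous_const
    intro z hz
    have sa := ha.smooth z hz
    have sb := hb.smooth z hz
    have ew : w =ᶠ[𝓝 z] fun z => a z - b z := ext0_eq (sa.sub sb)
    rw [lapC_congr_ev ew, lapC_sub sa sb, ha.pde z hz, hb.pde z hz]
    refine (abs_sub _ _).trans ?_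
    rw [abs_neg, abs_neg, abs_mul, abs_mul, abs_of_nonneg (by positivity : 0 ≤ (ε0 ^ 2)⁻¹),
      abs_of_nonneg (by positivity : 0 ≤ (ε ^ 2)⁻¹)]
    exact add_le_add (mul_le_mul_of_nonneg_left (ff_le hτ _) (by positivity))
      (mul_le_mul_of_nonneg_left (ff_le hτ _) (by positivity))
  have := H w sw pw ((ε ^ 2)⁻¹ * cA τ + C0) (N * M) ε hε (by positivity)
    (Eventually.of_forall hlap) (fun y => (hN1 _ (lapC_smooth sw).continuous.abs
      (pw.lapC.comp (fun t => |t|)) (fun _ => abs_nonneg _) y).trans (by gcongr)) z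
  calc ε * ‖gradC w z‖ ≤ ε * (C * (((ε ^ 2)⁻¹ * cA τ + C0) * ε + N * M / ε)) := by gcongr
    _ = C * (cA τ + ε ^ 2 * C0 + N * M) := by field_simp
    _ ≤ _ := by gcongr

lemma dv_log {p z : ℂ} (h : z ≠ p) (v : ℂ) :
    dv v (fun z => Real.log ‖z - p‖) z = ((z - p).re * v.re + (z - p).im * v.im) / ‖z - p‖ ^ 2 := by
  have h0 : ‖z - p‖ ^ 2 ≠ 0 := pow_ne_zero 2 (norm_ne_zero_iff.2 (sub_ne_zero.2 h))
  have e : (fun z => Real.log ‖z - p‖) = fun z => (1 / 2) * Real.log (‖z - p‖ ^ 2) := by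
    funext z; rw [Real.log_pow]; push_cast; ring
  have h1 : HasFDerivAt (fun z : ℂ => ‖z - p‖ ^ 2) _ z :=
    ((hasFDerivAt_id z).sub_const p).norm_sq
  have h2 := (h1.log h0).const_mul (1 / 2 : ℝ)
  rw [e, dv, h2.fderiv]
  simp [Complex.inner]
  ring

lemma log_smoothAt {p z : ℂ} (h : z ≠ p) : ContDiffAt ℝ ∞ (fun z => Real.log ‖z - p‖) z :=
  ((contDiffAt_id.sub contDiffAt_const).norm ℝ (sub_ne_zero.2 h)).log
    (norm_ne_zero_iff.2 (sub_ne_zero.2 h))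

lemma bracket_bound {b : ℂ → ℝ} {p : ℂ} {m r : ℝ}
    (hs : ∀ z ∈ closedBall p r, z ≠ p → ContDiffAt ℝ ∞ b z)
    (hp : ∃ v : ℂ → ℝ, ContDiffAt ℝ ∞ v p ∧ ∀ᶠ z in 𝓝[≠] p, b z = 2 * (-m) * Real.log ‖z - p‖ + v z) :
    ∃ G, 0 ≤ G ∧ ∀ z ∈ closedBall p r, z ≠ p →
      ‖gradC b z + (((2 * m * (z - p).re / ‖z - p‖ ^ 2 : ℝ) : ℂ)
        - Complex.I * ((2 * m * (z - p).im / ‖z - p‖ ^ 2 : ℝ) : ℂ))‖ ≤ G := by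
  obtain ⟨v, hv, he⟩ := hp
  set g : ℂ → ℝ := fun z => b z - (-(2 * m)) * Real.log ‖z - p‖ with hg
  have hgs : ∀ z ∈ closedBall p r, z ≠ p → ContDiffAt ℝ ∞ g z := fun z hz hzp =>
    (hs z hz hzp).sub (contDiffAt_const.mul (log_smoothAt hzp))
  have hgp : ext0 g =ᶠ[𝓝 p] v := by
    apply ext0_eq_of hv
    filter_upwards [he] with z hz
    simp only [hg, hz]; ring
  have hge : ∀ z ∈ closedBall p r, ContDiffAt ℝ ∞ (ext0 g) z := by
    intro z hz
    by_cases h : z = p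
    · subst h; exact hv.congr_of_eventuallyEq hgp
    · exact (hgs z hz h).congr_of_eventuallyEq (ext0_eq (hgs z hz h))
  have hcont : ContinuousOn (gradC (ext0 g)) (closedBall p r) := by
    intro z hz
    have h1 := (dv_smoothAt (hge z hz) 1).continuousAt
    have h2 := (dv_smoothAt (hge z hz) Complex.I).continuousAt
    have : ContinuousAt (gradC (ext0 g)) z :=
      (Complex.continuous_ofReal.continuousAt.comp h1).sub
        (continuousAt_const.mul (Complex.continuous_ofReal.continuousAt.comp h2))
    exact this.continuousWithinAt
  obtain ⟨G, hG⟩ := (isCompact_closedBall p r).exists_bound_of_continuousOn hcont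
  refine ⟨max 0 G, le_max_left _ _, fun z hz hzp => ?_⟩
  refine le_trans (le_of_eq ?_) ((hG z hz).trans (le_max_right _ _))
  congr 1
  have key : ∀ u, dv u (ext0 g) z = dv u b z + 2 * m * (((z - p).re * u.re + (z - p).im * u.im) / ‖z - p‖ ^ 2) := by
    intro u
    have hl := (log_smoothAt hzp).differentiableAt (by simp)
    rw [(dv_congr_ev (ext0_eq (hgs z hz hzp)) u).eq_of_nhds, hg,
      dv_sub ((hs z hz hzp).differentiableAt (by simp)) (hl.const_mul _)]
    have : dv u (fun z => -(2 * m) * Real.log ‖z - p‖) z =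
        -(2 * m) * dv u (fun z => Real.log ‖z - p‖) z := by
      simp only [dv]; rw [fderiv_const_mul hl]; simp
    rw [this, dv_log hzp]; ring
  simp only [gradC, key]
  simp
  ring

/-- identification of `ℂ` with the plane -/
def eC : ℂ ≃ₗᵢ[ℝ] Pl := Complex.orthonormalBasisOneI.repr

lemma eC_one : eC 1 = EuclideanSpace.single 0 (1:ℝ) := by
  have := Complex.orthonormalBasisOneI.repr_self 0
  simpa [eC] using this

lemma eC_I : eC Complex.I = EuclideanSpace.single 1 (1:ℝ) := by
  have := Complex.orthonormalBasisOneI.repr_self 1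
  simpa [eC] using this

lemma eC_apply (z : ℂ) : eC z = z.re • EuclideanSpace.single 0 (1:ℝ) +
    z.im • EuclideanSpace.single 1 (1:ℝ) := by
  rw [← eC_one, ← eC_I, ← map_smul, ← map_smul, ← map_add]
  congr 1
  apply Complex.ext <;> simp

lemma eC_zero_coord (z : ℂ) : eC z 0 = z.re := by rw [eC_apply]; simp
lemma eC_one_coord (z : ℂ) : eC z 1 = z.im := by rw [eC_apply]; simp

lemma dv_eC (g : Pl → ℝ) (z v : ℂ) : dv v (fun z => g (eC z)) z = fderiv ℝ g (eC z) (eC v) := by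
  have := eC.toContinuousLinearEquiv.comp_right_fderiv (f := g) (x := z)
  have h2 : fderiv ℝ (fun z => g (eC z)) z = _ := this
  rw [dv, h2]; rfl

lemma pd_eq_fderiv {g : Pl → ℝ} {x : Pl} (h : DifferentiableAt ℝ g x) (i : Fin 2) :
    pd g i x = fderiv ℝ g x (EuclideanSpace.single i (1:ℝ)) := h.lineDeriv_eq_fderiv

lemma pd_zero {g : Pl → ℝ} {z : ℂ} (h : DifferentiableAt ℝ g (eC z)) :
    pd g 0 (eC z) = dv 1 (fun z => g (eC z)) z := by
  rw [pd_eq_fderiv h, dv_eC, eC_one]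

lemma pd_one {g : Pl → ℝ} {z : ℂ} (h : DifferentiableAt ℝ g (eC z)) :
    pd g 1 (eC z) = dv Complex.I (fun z => g (eC z)) z := by
  rw [pd_eq_fderiv h, dv_eC, eC_I]

lemma pd_smoothAt {g : Pl → ℝ} {x : Pl} (h : ContDiffAt ℝ ∞ g x) (i : Fin 2) :
    ContDiffAt ℝ ∞ (pd g i) x := by
  have h1 : ContDiffAt ℝ ∞ (fun y => fderiv ℝ g y (EuclideanSpace.single i (1:ℝ))) x :=
    (h.fderiv_right (m := ∞) (by simp)).clm_apply contDiffAt_const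
  refine h1.congr_of_eventuallyEq ?_
  have := (h.of_le (m := 1) (by simp)).eventually (by simp)
  filter_upwards [this] with y hy
  exact pd_eq_fderiv (hy.differentiableAt (by simp)) i

lemma lap_eC {g : Pl → ℝ} {z : ℂ} (h : ContDiffAt ℝ ∞ g (eC z)) :
    lap g (eC z) = lapC (fun z => g (eC z)) z := by
  have ev : ∀ᶠ y in 𝓝 z, DifferentiableAt ℝ g (eC y) := by
    have := (h.of_le (m := 1) (by simp)).eventually (by simp)
    filter_upwards [eC.continuous.continuousAt.eventually this] with y hy
    exact hy.differentiableAt (by simp)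
  rw [lap, pd_zero ((pd_smoothAt h 0).differentiableAt (by simp)),
    pd_one ((pd_smoothAt h 1).differentiableAt (by simp)), lapC]
  have e0 : (fun z => pd g 0 (eC z)) =ᶠ[𝓝 z] dv 1 (fun z => g (eC z)) := by
    filter_upwards [ev] with y hy using pd_zero hy
  have e1 : (fun z => pd g 1 (eC z)) =ᶠ[𝓝 z] dv Complex.I (fun z => g (eC z)) := by
    filter_upwards [ev] with y hy using pd_one hy
  rw [(dv_congr_ev e0 _).eq_of_nhds, (dv_congr_ev e1 _).eq_of_nhds]

lemma unitLattice_eq : unitLattice = {x : Pl | x 0 ∈ range (Int.cast : ℤ → ℝ) ∧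
    x 1 ∈ range (Int.cast : ℤ → ℝ)} := by
  ext x
  simp only [unitLattice, mem_setOf_eq]
  constructor
  · rintro ⟨a, b, rfl⟩
    exact ⟨⟨a, by simp⟩, ⟨b, by simp⟩⟩
  · rintro ⟨⟨a, ha⟩, ⟨b, hb⟩⟩
    refine ⟨a, b, ?_⟩
    ext i
    fin_cases i
    · simpa using ha.symm
    · simpa using hb.symm

lemma unitLattice_closed : IsClosed unitLattice := by
  rw [unitLattice_eq]
  have hr : IsClosed (range (Int.cast : ℤ → ℝ)) := Int.isClosedEmbedding_coe_real.isClosed_range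
  have h0 : Continuous (fun x : Pl => x 0) := by fun_prop
  have h1 : Continuous (fun x : Pl => x 1) := by fun_prop
  exact (hr.preimage h0).inter (hr.preimage h1)

lemma unitLattice_countable : unitLattice.Countable := by
  have : unitLattice ⊆ range (fun p : ℤ × ℤ => (p.1 : ℝ) • EuclideanSpace.single 0 (1:ℝ) +
      (p.2 : ℝ) • (EuclideanSpace.single 1 (1:ℝ) : Pl)) := by
    rintro x ⟨a, b, rfl⟩
    exact ⟨(a, b), rfl⟩
  exact (countable_range _).mono this

lemma Z_eq (V : VortexData) : V.Z = (⋃ j, (fun x => x - V.p₁ j) ⁻¹' unitLattice) ∪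
    (⋃ j, (fun x => x - V.p₂ j) ⁻¹' unitLattice) := by
  ext x
  simp only [VortexData.Z, VortexData.Z1, VortexData.Z2, mem_union, mem_setOf_eq, mem_iUnion,
    mem_preimage]
  have key : ∀ q : Pl, (∃ v, v ∈ unitLattice ∧ x = q + v) ↔ x - q ∈ unitLattice := by
    intro q
    constructor
    · rintro ⟨v, hv, rfl⟩; simpa using hv
    · intro h; exact ⟨x - q, h, by simp⟩
  simp only [key]

lemma Z_closed (V : VortexData) : IsClosed V.Z := by
  rw [Z_eq]
  refine IsClosed.union ?_ ?_
  · exact isClosed_iUnion_of_finite fun j => unitLattice_closed.preimage (by fun_prop)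
  · exact isClosed_iUnion_of_finite fun j => unitLattice_closed.preimage (by fun_prop)

lemma Z_countable (V : VortexData) : V.Z.Countable := by
  rw [Z_eq]
  refine Countable.union ?_ ?_
  · exact countable_iUnion fun j => unitLattice_countable.preimage sub_left_injective
  · exact countable_iUnion fun j => unitLattice_countable.preimage sub_left_injective

lemma sing_eC {U : Pl → ℝ} {q ℓ : Pl} {c : ℝ} (hU : Periodic2 U) (hs : LogSing U q c)
    (hl : ℓ ∈ unitLattice) {p : ℂ} (hp : eC p = q + ℓ) :
    ∃ v : ℂ → ℝ, ContDiffAt ℝ ∞ v p ∧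
      ∀ᶠ z in 𝓝[≠] p, U (eC z) = 2 * c * Real.log ‖z - p‖ + v z := by
  obtain ⟨r, hr, v, hv, he⟩ := hs
  have hq : eC p - ℓ = q := by rw [hp]; simp
  refine ⟨fun z => v (eC z - ℓ), ?_, ?_⟩
  · have h1 : ContDiffAt ℝ ∞ v (eC p - ℓ) := by
      rw [hq]
      exact hv.contDiffAt (ball_mem_nhds q hr)
    have h2 : ContDiffAt ℝ ∞ (fun z => eC z - ℓ) p :=
      (eC.toContinuousLinearEquiv.contDiff.contDiffAt).sub contDiffAt_const
    exact h1.comp p h2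
  · have hn : ∀ z, ‖eC z - ℓ - q‖ = ‖z - p‖ := by
      intro z
      rw [← eC.norm_map (z - p), map_sub, hp]; congr 1; abel
    filter_upwards [nhdsWithin_le_nhds (ball_mem_nhds p hr), self_mem_nhdsWithin] with z hz hzp
    have hper : U (eC z) = U (eC z - ℓ) := by
      have := hU (eC z - ℓ) ℓ hl
      rw [← this]; simp
    rw [hper, he (eC z - ℓ) ?_ ?_, hn]
    · rw [mem_ball, dist_eq_norm, hn, ← dist_eq_norm]; exact hz
    · intro h
      have h3 := hn z
      rw [h, sub_self, norm_zero] at h3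
      exact hzp (sub_eq_zero.1 (norm_eq_zero.1 h3.symm))

lemma smooth_eC {V : VortexData} {τ ε : ℝ} {U : Pl → ℝ} (h : IsSolution V τ ε U) {x : Pl}
    (hx : x ∉ V.Z) : ContDiffAt ℝ ∞ U x :=
  h.smooth.contDiffAt ((Z_closed V).isOpen_compl.mem_nhds hx)

lemma exists_weight (V : VortexData) (τ : ℝ) (ε : ℕ → ℝ) (u : ℕ → Pl → ℝ)
    (hu : ∀ n, IsSolution V τ (ε n) (u n)) (p : ℂ) : ∃ c : ℝ, ∀ n, ∃ v : ℂ → ℝ,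
      ContDiffAt ℝ ∞ v p ∧ ∀ᶠ z in 𝓝[≠] p, u n (eC z) = 2 * c * Real.log ‖z - p‖ + v z := by
  by_cases hp : eC p ∈ V.Z
  · rcases hp with ⟨j, ℓ, hl, h⟩ | ⟨j, ℓ, hl, h⟩
    · exact ⟨V.m₁ j, fun n => sing_eC (hu n).periodic ((hu n).sing₁ j) hl h⟩
    · exact ⟨-(V.m₂ j), fun n => sing_eC (hu n).periodic ((hu n).sing₂ j) hl h⟩
  · refine ⟨0, fun n => ⟨fun z => u n (eC z), ?_, Eventually.of_forall fun z => by simp⟩⟩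
    exact (smooth_eC (hu n) hp).comp p eC.toContinuousLinearEquiv.contDiff.contDiffAt

lemma per_eC {U : Pl → ℝ} (hU : Periodic2 U) : PerC (fun z => U (eC z)) := by
  intro z
  simp only [map_add]
  refine ⟨hU _ _ ⟨1, 0, ?_⟩, hU _ _ ⟨0, 1, ?_⟩⟩
  · rw [eC_one]; simp
  · rw [eC_I]; simp

lemma solC_of {V : VortexData} {τ ε : ℝ} {U : Pl → ℝ} (h : IsSolution V τ ε U) {s : ℂ → ℝ}
    (hs : LogS s (fun z => U (eC z))) : SolC (eC ⁻¹' V.Z) s τ ε (fun z => U (eC z)) where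
  per := per_eC h.periodic
  smooth := fun z hz => (smooth_eC h hz).comp z eC.toContinuousLinearEquiv.contDiff.contDiffAt
  pde := fun z hz => by
    rw [← lap_eC (smooth_eC h hz)]
    have := h.pde (eC z) hz
    have e : ff τ (U (eC z)) = fτ τ (U (eC z)) := rfl
    rw [e]; linarith
  sing := hs

lemma pd_scale {U : Pl → ℝ} {q x : Pl} {ε : ℝ} (i : Fin 2)
    (h : DifferentiableAt ℝ U (q + ε • (x - q))) :
    pd (fun y => U (q + ε • (y - q))) i x = ε * pd U i (q + ε • (x - q)) := by
  have h1 : HasFDerivAt (fun y : Pl => q + ε • (y - q)) (ε • ContinuousLinearMap.id ℝ Pl) x :=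
    (((hasFDerivAt_id x).sub_const q).const_smul ε).const_add q
  have h2 := h.hasFDerivAt.comp x h1
  have h3 : HasFDerivAt (fun y => U (q + ε • (y - q))) _ x := h2
  rw [pd_eq_fderiv h3.differentiableAt, pd_eq_fderiv h, h3.fderiv]
  simp

end

/-- **gradient estimate for the rescaled solution.** Fix `p = p_{j,2}` and
a radius `r₀ > 0` isolating `p` from the other vortices, and let
`û_ε(x) = u_ε(p + ε(x − p))` (the blow-up of `u_ε` at `p`), which solves
`Δû_ε + f_τ(û_ε) = −4π m_{j,2} δ_p` on `B_{r/ε}(p)`. Then there is `c > 0`, independent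
of `r` and `ε`, with `|∇û_ε(x) + 2 m_{j,2}(x−p)/|x−p|²| ≤ c` on `B_{r/ε}(p)`. -/
theorem rescaled_gradient_bound
    (V : VortexData) (τ : ℝ) (hτ : 0 < τ)
    (ε : ℕ → ℝ) (hε : ∀ n, 0 < ε n) (hε0 : Tendsto ε atTop (nhds 0))
    (u : ℕ → Pl → ℝ) (hu : ∀ n, IsSolution V τ (ε n) (u n))
    (j : Fin V.d₂) (r₀ : ℝ) (hr₀ : 0 < r₀)
    (hiso : closedBall (V.p₂ j) r₀ ∩ V.Z = {V.p₂ j}) :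
    ∃ c > 0, ∀ r ∈ Ioo (0:ℝ) r₀, ∀ n : ℕ, ∀ x : Pl,
      x ≠ V.p₂ j → dist x (V.p₂ j) < r / ε n →
        Real.sqrt
          ((pd (fun y => u n (V.p₂ j + ε n • (y - V.p₂ j))) 0 x
              + 2 * V.m₂ j * (x - V.p₂ j) 0 / ‖x - V.p₂ j‖ ^ 2) ^ 2 +
           (pd (fun y => u n (V.p₂ j + ε n • (y - V.p₂ j))) 1 x
              + 2 * V.m₂ j * (x - V.p₂ j) 1 / ‖x - V.p₂ j‖ ^ 2) ^ 2) ≤ c := by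
  obtain ⟨E, hE⟩ := hε0.bddAbove_range
  have hE' : ∀ n, ε n ≤ E := fun n => hE ⟨n, rfl⟩
  have hE0 : 0 < E := (hε 0).trans_le (hE' 0)
  choose s hs using exists_weight V τ ε u hu
  have hsol : ∀ n, SolC (eC ⁻¹' V.Z) s τ (ε n) (fun z => u n (eC z)) := fun n =>
    solC_of (hu n) (fun p => hs p n)
  obtain ⟨C, hC0, hC⟩ := gradw_bound ((Z_countable V).preimage eC.injective) hτ (hsol 0) E
  obtain ⟨p, hp⟩ : ∃ p, eC p = V.p₂ j := ⟨eC.symm (V.p₂ j), by simp⟩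
  have hoff : ∀ z ∈ closedBall p r₀, z ≠ p → eC z ∉ V.Z := by
    intro z hz hzp hmem
    have h1 : eC z ∈ closedBall (V.p₂ j) r₀ ∩ V.Z := by
      refine ⟨?_, hmem⟩
      rw [mem_closedBall, ← hp, eC.dist_map]; exact hz
    rw [hiso, mem_singleton_iff, ← hp] at h1
    exact hzp (eC.injective h1)
  have hl0 : (0 : Pl) ∈ unitLattice := ⟨0, 0, by simp⟩
  obtain ⟨G, hG0, hG⟩ := bracket_bound (b := fun z => u 0 (eC z)) (p := p) (m := V.m₂ j) (r := r₀)
    (fun z hz hzp => (hsol 0).smooth z (hoff z hz hzp))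
    (sing_eC (hu 0).periodic ((hu 0).sing₂ j) hl0 (by rw [hp, add_zero]))
  refine ⟨C + E * G + 1, by positivity, ?_⟩
  intro r hr n x hx hd
  have hen := hε n
  obtain ⟨d, hd'⟩ : ∃ d, eC d = ε n • (x - V.p₂ j) := ⟨eC.symm (ε n • (x - V.p₂ j)), eC.apply_symm_apply _⟩
  have hz : V.p₂ j + ε n • (x - V.p₂ j) = eC (p + d) := by rw [map_add, hp, hd']
  have hxq : x - V.p₂ j = (ε n)⁻¹ • eC d := by
    rw [hd', smul_smul, inv_mul_cancel₀ hen.ne', one_smul]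
  have hdn : ‖d‖ = ε n * ‖x - V.p₂ j‖ := by
    rw [← eC.norm_map, hd', norm_smul, Real.norm_of_nonneg hen.le]
  have hxn : 0 < ‖x - V.p₂ j‖ := norm_pos_iff.2 (sub_ne_zero.2 hx)
  have hdp : 0 < ‖d‖ := by rw [hdn]; positivity
  have hzp : p + d ≠ p := by
    intro h
    rw [add_eq_left] at h
    rw [h, norm_zero] at hdp; exact lt_irrefl _ hdp
  have hzb : p + d ∈ closedBall p r₀ := by
    rw [mem_closedBall, dist_eq_norm, add_sub_cancel_left, hdn]
    rw [dist_eq_norm, lt_div_iff₀ hen] at hd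
    have := hr.2
    linarith
  have hnZ := hoff _ hzb hzp
  have hUd : DifferentiableAt ℝ (u n) (eC (p + d)) :=
    (smooth_eC (hu n) hnZ).differentiableAt (by simp)
  have ha := (hsol n).smooth _ hnZ
  have hb := (hsol 0).smooth _ hnZ
  have hgr : gradC (fun z => u n (eC z)) (p + d) =
      gradC (ext0 (fun z => u n (eC z) - u 0 (eC z))) (p + d)
        + gradC (fun z => u 0 (eC z)) (p + d) := by
    have e := ext0_eq (ha.sub hb)
    have e' : ext0 (fun z => u n (eC z) - u 0 (eC z)) =ᶠ[𝓝 (p + d)]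
      (fun z => u n (eC z) - u 0 (eC z)) := e
    simp only [gradC, (dv_congr_ev e' _).eq_of_nhds,
      dv_sub (ha.differentiableAt (by simp)) (hb.differentiableAt (by simp))]
    push_cast
    ring
  have h1 := hC (ε n) hen (hE' n) _ (hsol n) (p + d)
  have h2 := hG (p + d) hzb hzp
  rw [add_sub_cancel_left] at h2
  have hUd' : DifferentiableAt ℝ (u n) (V.p₂ j + ε n • (x - V.p₂ j)) := by rw [hz]; exact hUd
  rw [pd_scale 0 hUd', pd_scale 1 hUd', hz, pd_zero hUd, pd_one hUd]
  have hc0 : (x - V.p₂ j) 0 = (ε n)⁻¹ * d.re := by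
    rw [hxq]; simp [eC_zero_coord]
  have hc1 : (x - V.p₂ j) 1 = (ε n)⁻¹ * d.im := by
    rw [hxq]; simp [eC_one_coord]
  have hxn' : ‖x - V.p₂ j‖ = (ε n)⁻¹ * ‖d‖ := by
    rw [hdn, ← mul_assoc, inv_mul_cancel₀ hen.ne', one_mul]
  have q : ∀ t : ℝ, 2 * V.m₂ j * ((ε n)⁻¹ * t) / ((ε n)⁻¹ * ‖d‖) ^ 2
      = ε n * (2 * V.m₂ j * t / ‖d‖ ^ 2) := by
    intro t
    field_simp
  rw [hc0, hc1, hxn', q, q]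
  set A := dv 1 (fun z => u n (eC z)) (p + d) with hA
  set B := dv Complex.I (fun z => u n (eC z)) (p + d) with hB
  set a := 2 * V.m₂ j * d.re / ‖d‖ ^ 2
  set b := 2 * V.m₂ j * d.im / ‖d‖ ^ 2
  have hsq : Real.sqrt ((ε n * A + ε n * a) ^ 2 + (ε n * B + ε n * b) ^ 2)
      = ε n * ‖gradC (fun z => u n (eC z)) (p + d) + ((a : ℂ) - Complex.I * (b : ℂ))‖ := by
    have e : gradC (fun z => u n (eC z)) (p + d) + ((a : ℂ) - Complex.I * (b : ℂ))
        = (⟨A + a, -(B + b)⟩ : ℂ) := by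
      apply Complex.ext <;> simp [gradC, ← hA, ← hB] <;> ring
    rw [e, Complex.norm_def, Complex.normSq_mk,
      show (ε n * A + ε n * a) ^ 2 + (ε n * B + ε n * b) ^ 2 =
        (ε n) ^ 2 * ((A + a) * (A + a) + -(B + b) * -(B + b)) by ring,
      Real.sqrt_mul (sq_nonneg _), Real.sqrt_sq hen.le]
  rw [hsq, hgr, add_assoc]
  have h3 := norm_add_le (gradC (ext0 (fun z => u n (eC z) - u 0 (eC z))) (p + d))
    (gradC (fun z => u 0 (eC z)) (p + d) + ((a : ℂ) - Complex.I * (b : ℂ)))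
  have h4 := mul_le_mul_of_nonneg_left h3 hen.le
  rw [mul_add] at h4
  have h5 := mul_le_mul (hE' n) h2 (norm_nonneg _) hE0.le
  linarith
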